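/- arXiv:2012.14380 — 2 statements merged into one kernel-verified Lean document; each statement's English description precedes it below -/
import Mathlib

section
/- If P is a d-polytope with d > 4, then f_1(P) ≠ ⌊(d/2)·f_0(P) + 1⌋; equivalently, the excess degree 2·f_1(P) − d·f_0(P) is never equal to 1 or 2 when d > 4. -/
open Set

/-- A polytope: the convex hull of a finite set of points. -/
def IsPolytope {n : ℕ} (P : Set (Fin n → ℝ)) : Prop :=
  ∃ S : Finset (Fin n → ℝ), P = convexHull ℝ (S : Set (Fin n → ℝ))

/-- The affine dimension of a set: the rank of its vector span. -/
noncomputable def adim {n : ℕ} (P : Set (Fin n → ℝ)) : ℕ :=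
  Module.finrank ℝ (vectorSpan ℝ P)

/-- A `d`-polytope: a polytope whose affine hull has dimension `d`. -/
def IsDPolytope (d : ℕ) {n : ℕ} (P : Set (Fin n → ℝ)) : Prop :=
  IsPolytope P ∧ adim P = d

/-- An edge of `P`: a face (an extreme convex subset) of affine dimension 1. -/
def IsEdge {n : ℕ} (P E : Set (Fin n → ℝ)) : Prop :=
  IsExtreme ℝ P E ∧ Convex ℝ E ∧ adim E = 1

/-- `f₀ P`: the number of vertices (extreme points) of `P`. -/
noncomputable def f₀ {n : ℕ} (P : Set (Fin n → ℝ)) : ℕ :=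
  (Set.extremePoints ℝ P).ncard

/-- `f₁ P`: the number of edges of `P`. -/
noncomputable def f₁ {n : ℕ} (P : Set (Fin n → ℝ)) : ℕ :=
  {E : Set (Fin n → ℝ) | IsEdge P E}.ncard

/-- `E^d`: the set of `(f₀, f₁)` pairs realized by `d`-polytopes. -/
def fPairs (d : ℕ) : Set (ℕ × ℕ) :=
  {p | ∃ (n : ℕ) (P : Set (Fin n → ℝ)), IsDPolytope d P ∧ f₀ P = p.1 ∧ f₁ P = p.2}

theorem not_codim_one {ι : Type*} (N S : Finset ι) (L : Set (ι → ℝ)) (hSN : S ⊆ N) (hS : 5 ≤ S.card)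
    (H : ∀ w ∈ S, ∃ z ∈ N, ∃ r ∈ L, 0 < r w ∧ 0 < r z ∧ (∀ i ∈ N, i ≠ w → i ≠ z → r i ≤ 0) ∧
      ∀ l ∈ L, ∃ k : ℝ, ∀ i ∈ N, l i = k * r i) : False := by
  classical
  obtain ⟨w, hw⟩ : S.Nonempty := Finset.card_pos.mp (by omega)
  obtain ⟨z, hz, r, hr, hrw, hrz, hneg, huniq⟩ := H w hw
  have key : ∀ u ∈ S, u ≠ w → u ≠ z → ∃ z', r u < 0 ∧ ∀ i ∈ N, r i < 0 → i = u ∨ i = z' := by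
    intro u hu huw huz
    obtain ⟨z', hz', s, hs, hsu, hsz, hsneg, -⟩ := H u hu
    obtain ⟨k, hk⟩ := huniq s hs
    have h1 := hk u (hSN hu)
    have h2 := hneg u (hSN hu) huw huz
    have hk0 : k < 0 := by
      by_contra h
      nlinarith
    refine ⟨z', by nlinarith, fun i hi hri => ?_⟩
    by_contra! hne
    have := hsneg i hi hne.1 hne.2
    rw [hk i hi] at this
    nlinarith
  have hcard : 3 ≤ ((S.erase w).erase z).card := by
    have h1 := Finset.pred_card_le_card_erase (s := S) (a := w)
    have h2 := Finset.pred_card_le_card_erase (s := S.erase w) (a := z)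
    omega
  obtain ⟨a, b, c, ha, hb, hc, hab, hac, hbc⟩ := Finset.two_lt_card_iff.mp (show 2 < _ from hcard)
  simp only [Finset.mem_erase] at ha hb hc
  obtain ⟨z', h1, h2⟩ := key a ha.2.2 ha.2.1 ha.1
  obtain ⟨_, h3, -⟩ := key b hb.2.2 hb.2.1 hb.1
  obtain ⟨_, h4, -⟩ := key c hc.2.2 hc.2.1 hc.1
  have h5 := h2 b (hSN hb.2.2) h3
  have h6 := h2 c (hSN hc.2.2) h4
  grind

theorem codim_two_step {ι : Type*} (N : Finset ι) (L : Set (ι → ℝ))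
    (H : ∀ w ∈ N, ∃ z ∈ N, ∃ z' ∈ N, ∃ s ∈ L, ∃ s' ∈ L, s z = 1 ∧ s z' = 0 ∧ s' z = 0 ∧ s' z' = 1 ∧
      0 < s w ∧ 0 < s' w ∧ (∀ i ∈ N, i ≠ w → i ≠ z → i ≠ z' → s i ≤ 0 ∧ s' i ≤ 0) ∧
      ∀ l ∈ L, ∀ i ∈ N, l i = l z * s i + l z' * s' i)
    {w z z' : ι} {r r' : ι → ℝ} (hw : w ∈ N) (hz : z ∈ N) (hz' : z' ∈ N) (hr : r ∈ L) (hr' : r' ∈ L)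
    (hrz : r z = 1) (hrz' : r z' = 0) (hrz2 : r' z = 0) (hrz2' : r' z' = 1) (hrw : 0 < r w) (hrw' : 0 < r' w)
    (hneg : ∀ i ∈ N, i ≠ w → i ≠ z → i ≠ z' → r i ≤ 0 ∧ r' i ≤ 0)
    (huniq : ∀ l ∈ L, ∀ i ∈ N, l i = l z * r i + l z' * r' i) :
    ∃ b ∈ N, b ≠ w ∧ b ≠ z ∧ b ≠ z' ∧ ∃ s ∈ L, ∃ s' ∈ L, s w = 1 ∧ s b = 0 ∧ s' w = 0 ∧ s' b = 1 ∧
      0 < s z ∧ 0 < s' z ∧ (∀ i ∈ N, i ≠ z → i ≠ w → i ≠ b → s i ≤ 0 ∧ s' i ≤ 0) ∧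
      ∀ l ∈ L, ∀ i ∈ N, l i = l w * s i + l b * s' i := by
  suffices hh : ∀ y ∈ N, ∀ y' ∈ N, ∀ s ∈ L, ∀ s' ∈ L, s y = 1 → s y' = 0 → s' y = 0 → s' y' = 1 →
      0 < s z → 0 < s' z → (∀ i ∈ N, i ≠ z → i ≠ y → i ≠ y' → s i ≤ 0 ∧ s' i ≤ 0) →
      (∀ l ∈ L, ∀ i ∈ N, l i = l y * s i + l y' * s' i) → y = w → y' ≠ w ∧ y' ≠ z ∧ y' ≠ z' by
    obtain ⟨y, hy, y', hy', s, hs, s', hs', h1, h2, h3, h4, h5, h6, h7, h8⟩ := H z hz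
    by_cases hyw : y = w
    · have := hh y hy y' hy' s hs s' hs' h1 h2 h3 h4 h5 h6 h7 h8 hyw
      subst hyw
      exact ⟨y', hy', this.1, this.2.1, this.2.2, s, hs, s', hs', h1, h2, h3, h4, h5, h6, h7, h8⟩
    by_cases hyw' : y' = w
    · have h7' : ∀ i ∈ N, i ≠ z → i ≠ y' → i ≠ y → s' i ≤ 0 ∧ s i ≤ 0 :=
        fun i hi a b c => (h7 i hi a c b).symm
      have h8' : ∀ l ∈ L, ∀ i ∈ N, l i = l y' * s' i + l y * s i := fun l hl i hi => by
        rw [h8 l hl i hi]; ring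
      have := hh y' hy' y hy s' hs' s hs h4 h3 h2 h1 h6 h5 h7' h8' hyw'
      subst hyw'
      exact ⟨y, hy, this.1, this.2.1, this.2.2, s', hs', s, hs, h4, h3, h2, h1, h6, h5, h7', h8'⟩
    exfalso
    have hyz : y ≠ z := by rintro rfl; linarith
    have hyz' : y' ≠ z := by rintro rfl; linarith
    have hwz : w ≠ z := by rintro rfl; linarith
    obtain ⟨h9, h10⟩ := h7 w hw hwz (Ne.symm hyw) (Ne.symm hyw')
    rw [huniq s hs w hw] at h9
    rw [huniq s' hs' w hw] at h10
    have h11 : s z' < 0 := by nlinarith [mul_pos h5 hrw]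
    have h12 : y ≠ z' := by rintro rfl; linarith
    have h13 : y' ≠ z' := by rintro rfl; linarith
    have h14 := hneg y hy hyw hyz h12
    have h15 := hneg y' hy' hyw' hyz' h13
    have h16 := h8 r hr z hz
    nlinarith
  rintro y hy y' hy' s hs s' hs' h1 h2 h3 h4 h5 h6 h7 h8 rfl
  refine ⟨?_, ?_, ?_⟩
  · rintro rfl; linarith
  · rintro rfl; linarith
  · rintro rfl
    have := h8 r' hr' z hz
    nlinarith [mul_pos hrw' h5]

theorem not_codim_two {ι : Type*} (N : Finset ι) (L : Set (ι → ℝ)) (hN : 7 ≤ N.card)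
    (H : ∀ w ∈ N, ∃ z ∈ N, ∃ z' ∈ N, ∃ s ∈ L, ∃ s' ∈ L, s z = 1 ∧ s z' = 0 ∧ s' z = 0 ∧ s' z' = 1 ∧
      0 < s w ∧ 0 < s' w ∧ (∀ i ∈ N, i ≠ w → i ≠ z → i ≠ z' → s i ≤ 0 ∧ s' i ≤ 0) ∧
      ∀ l ∈ L, ∀ i ∈ N, l i = l z * s i + l z' * s' i) : False := by
  classical
  obtain ⟨w, hw⟩ : N.Nonempty := Finset.card_pos.mp (by omega)
  obtain ⟨z, hz, z', hz', r, hr, r', hr', h1, h2, h3, h4, h5, h6, h7, h8⟩ := H w hw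
  have hzz : z ≠ z' := by rintro rfl; linarith
  obtain ⟨b, hb, hbw, hbz, hbz', s, hs, s', hs', hsw, hsb, hsw', hsb', hsz, hsz', hsneg, hsuniq⟩ :=
    codim_two_step N L H hw hz hz' hr hr' h1 h2 h3 h4 h5 h6 h7 h8
  obtain ⟨c, hc, hcw, hcz', hcz, u, hu, u', hu', huw, huc, huw', huc', huz, huz', huneg, -⟩ :=
    codim_two_step N L H hw hz' hz hr' hr h4 h3 h2 h1 h6 h5
      (fun i hi x y z => (h7 i hi x z y).symm)
      (fun l hl i hi => by rw [h8 l hl i hi]; ring)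
  have hwz : w ≠ z := by rintro rfl; linarith
  have hwz' : w ≠ z' := by rintro rfl; linarith
  have hbc : b ≠ c := by
    rintro rfl
    have e1 := hsuniq u' hu' z hz
    have e2 := (huneg z hz hzz hwz.symm hbz.symm).2
    nlinarith
  have hk : u' b ≤ 0 := (huneg b hb hbz' hbw hbc).2
  have hprop : ∀ i ∈ N, u' i = u' b * s' i := fun i hi => by
    rw [hsuniq u' hu' i hi, huw']; ring
  have hk0 : u' b < 0 := by
    rcases hk.lt_or_eq with h | h
    · exact h
    · have := hprop c hc
      rw [h, huc'] at this
      linarith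
  have hpar : ∀ i ∈ N, i ≠ w → i ≠ z → i ≠ z' → i ≠ b → i ≠ c →
      s i ≤ 0 ∧ ∀ l ∈ L, l i = l w * s i := by
    intro i hi g1 g2 g3 g4 g5
    have e1 := hsneg i hi g2 g1 g4
    have e2 := (huneg i hi g3 g1 g5).2
    rw [hprop i hi] at e2
    have e3 : s' i = 0 := by nlinarith
    refine ⟨e1.1, fun l hl => ?_⟩
    rw [hsuniq l hl i hi, e3]; ring
  have hcard : 1 < (N \ {w, z, z', b, c}).card := by
    have h1 := Finset.le_card_sdiff {w, z, z', b, c} N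
    have h2 : ({w, z, z', b, c} : Finset ι).card ≤ 5 := Finset.card_le_five
    omega
  obtain ⟨x, hx, y, hy, hxy⟩ := Finset.one_lt_card.mp hcard
  simp only [Finset.mem_sdiff, Finset.mem_insert, Finset.mem_singleton, not_or] at hx hy
  obtain ⟨hx1, hx2⟩ := hpar x hx.1 hx.2.1 hx.2.2.1 hx.2.2.2.1 hx.2.2.2.2.1 hx.2.2.2.2.2
  obtain ⟨hy1, hy2⟩ := hpar y hy.1 hy.2.1 hy.2.2.1 hy.2.2.2.1 hy.2.2.2.2.1 hy.2.2.2.2.2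
  have hsy : s y < 0 := by
    rcases hy1.lt_or_eq with h | h
    · exact h
    · obtain ⟨_, -, _, -, p, hp, _, _, _, _, _, _, h0, -⟩ := H y hy.1
      have := hy2 p hp
      rw [h] at this
      linarith
  obtain ⟨t, ht, t', ht', p, hp, p', hp', k1, k2, k3, k4, k5, k6, k7, -⟩ := H x hx.1
  have pos : ∀ q ∈ L, 0 < q x → 0 < q y := by
    intro q hq h
    rw [hx2 q hq] at h
    rw [hy2 q hq]
    have : q w < 0 := by
      by_contra hcon
      nlinarith
    nlinarith
  have q1 := pos p hp k5
  have q2 := pos p' hp' k6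
  have := (k7 y hy.1 hxy.symm (by rintro rfl; linarith) (by rintro rfl; linarith)).1
  linarith

/-- `InCone N v u`: the point `u` lies in the cone with apex `v` spanned by the points of `N`. -/
def InCone {E : Type*} [AddCommGroup E] [Module ℝ E] (N : Finset E) (v u : E) : Prop :=
  ∃ c : E → ℝ, (∀ i ∈ N, 0 ≤ c i) ∧ u - v = ∑ i ∈ N, c i • (i - v)

/-- The linear dependences among the vectors `i - v`, `i ∈ N`. -/
def dependences {E : Type*} [AddCommGroup E] [Module ℝ E] (N : Finset E) (v : E) : Set (E → ℝ) :=
  {l | ∑ i ∈ N, l i • (i - v) = 0}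

theorem exists_dual_family {E : Type*} [AddCommGroup E] [Module ℝ E] {ι : Type*} [DecidableEq ι] {b : ι → E}
    (hb : LinearIndependent ℝ b) : ∃ φ : ι → E →ₗ[ℝ] ℝ, ∀ i j, φ i (b j) = if i = j then 1 else 0 := by
  obtain ⟨g, hg⟩ := LinearMap.exists_leftInverse_of_injective
    (Finsupp.linearCombination ℝ b) (LinearMap.ker_eq_bot.mpr hb)
  refine ⟨fun i => (Finsupp.lapply i).comp g, fun i j => ?_⟩
  have : g (b j) = Finsupp.single j 1 := by
    have := LinearMap.congr_fun hg (Finsupp.single j 1)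
    simpa using this
  simp [this, Finsupp.single_apply, eq_comm]

theorem exists_neighbor_on_face {E : Type*} [AddCommGroup E] [Module ℝ E] [DecidableEq E] {v w : E}
    {N A : Finset E} (hvA : v ∉ A) (φ : E → E →ₗ[ℝ] ℝ)
    (hφ : ∀ a ∈ A, ∀ n ∈ insert v A, φ a (n - w) = if a = n then 1 else 0)
    (hw : ∀ i ∈ N, InCone (insert v A) w i) (hv : ∀ a ∈ A, InCone N v a)
    {a : E} (ha : a ∈ A) :
    ∃ b ∈ N, 0 < φ a (b - v) ∧ ∀ n ∈ A, n ≠ a → φ n (b - v) = 0 := by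
  have hφw : ∀ n ∈ A, φ n (w - v) = 0 := fun n hn => by
    have := hφ n hn v (Finset.mem_insert_self _ _)
    rw [if_neg (by rintro rfl; exact hvA hn)] at this
    rw [← neg_sub, map_neg, this, neg_zero]
  have hnn : ∀ n ∈ A, ∀ i ∈ N, 0 ≤ φ n (i - v) := by
    intro n hn i hi
    obtain ⟨c, hc, h⟩ := hw i hi
    rw [← sub_add_sub_cancel i w v, map_add, hφw n hn, add_zero, h, map_sum]
    refine Finset.sum_nonneg fun m hm => ?_
    rw [map_smul, hφ n hn m hm, smul_eq_mul]
    exact mul_nonneg (hc m hm) (by split_ifs <;> norm_num)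
  obtain ⟨c, hc, h⟩ := hv a ha
  have hsum : ∀ n ∈ A, ∑ i ∈ N, c i * φ n (i - v) = if n = a then 1 else 0 := by
    intro n hn
    have h1 : φ n (a - v) = if n = a then 1 else 0 := by
      rw [← sub_add_sub_cancel a w v, map_add, hφw n hn, add_zero, hφ n hn a (Finset.mem_insert_of_mem ha)]
    rw [← h1, h, map_sum]
    simp
  have h1 := hsum a ha
  rw [if_pos rfl] at h1
  obtain ⟨b, hb, hb'⟩ := Finset.exists_lt_of_sum_lt (s := N) (f := fun _ => (0 : ℝ)) (g := fun i => c i * φ a (i - v))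
    (by rw [h1]; simp)
  have hcb : 0 < c b := (hc b hb).lt_of_ne (by rintro h; simp [← h] at hb')
  refine ⟨b, hb, pos_of_mul_pos_right hb' hcb.le, fun n hn hna => ?_⟩
  have h2 := hsum n hn
  rw [if_neg hna, Finset.sum_eq_zero_iff_of_nonneg (fun i hi => mul_nonneg (hc i hi) (hnn n hn i hi))] at h2
  exact (mul_eq_zero.mp (h2 b hb)).resolve_left hcb.ne'

theorem exists_dependences_of_simple {E : Type*} [AddCommGroup E] [Module ℝ E] [DecidableEq E] {v w : E}
    {N A : Finset E} (hvA : v ∉ A) (hwv : w ≠ v) (hwN : w ∈ N)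
    (hli : LinearIndependent ℝ (fun n : (insert v A : Finset E) => (n : E) - w))
    (hw : ∀ i ∈ N, InCone (insert v A) w i) (hv : ∀ a ∈ A, InCone N v a)
    (hmin : ∀ z ∈ N, ¬ InCone (N.erase z) v z) :
    ∃ Z ⊆ N, w ∉ Z ∧ Z.card + (A.card + 1) = N.card ∧
      (∀ z ∈ Z, ∃ r ∈ dependences N v, r z = 1 ∧ (∀ y ∈ Z, y ≠ z → r y = 0) ∧ 0 < r w ∧
        ∀ i ∈ N, i ∉ Z → i ≠ w → r i ≤ 0) ∧
      ∀ l ∈ dependences N v, (∀ z ∈ Z, l z = 0) → ∀ i ∈ N, l i = 0 := by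
  obtain ⟨ψ, hψ⟩ := exists_dual_family hli
  let φ : E → E →ₗ[ℝ] ℝ := fun a => if h : a ∈ insert v A then ψ ⟨a, h⟩ else 0
  have hφ : ∀ a ∈ A, ∀ n ∈ insert v A, φ a (n - w) = if a = n then 1 else 0 := by
    intro a ha n hn
    have ha' := Finset.mem_insert_of_mem (b := v) ha
    have := hψ ⟨a, ha'⟩ ⟨n, hn⟩
    simp only [φ, dif_pos ha']
    simpa using this
  have hφw : ∀ n ∈ A, φ n (w - v) = 0 := fun n hn => by
    have := hφ n hn v (Finset.mem_insert_self _ _)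
    rw [if_neg (by rintro rfl; exact hvA hn)] at this
    rw [← neg_sub, map_neg, this, neg_zero]
  have hex := fun a (ha : a ∈ A) => exists_neighbor_on_face hvA φ hφ hw hv ha
  choose! b hbN hbpos hbzero using hex
  have hbinj : ∀ a ∈ A, ∀ a' ∈ A, b a = b a' → a = a' := by
    intro a ha a' ha' h
    by_contra hne
    have h1 := hbpos a ha
    rw [h, hbzero a' ha' a ha hne] at h1
    exact lt_irrefl _ h1
  have hbw : ∀ a ∈ A, b a ≠ w := by
    intro a ha h
    have h1 := hbpos a ha
    rw [h, hφw a ha] at h1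
    exact lt_irrefl _ h1
  have hexp : ∀ i ∈ N, ∃ t : ℝ, i - v = ∑ a ∈ A, φ a (i - v) • (a - w) + t • (w - v) := by
    intro i hi
    obtain ⟨c, -, h⟩ := hw i hi
    rw [Finset.sum_insert hvA] at h
    have hc : ∀ a ∈ A, φ a (i - v) = c a := by
      intro a ha
      rw [← sub_add_sub_cancel i w v, map_add, hφw a ha, add_zero, h, map_add, map_smul, map_sum,
        hφ a ha v (Finset.mem_insert_self _ _), if_neg (by rintro rfl; exact hvA ha), smul_zero, zero_add]
      rw [Finset.sum_congr rfl (g := fun n => if a = n then c n else 0)]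
      · simp [ha]
      · intro n hn
        rw [map_smul, hφ a ha n (Finset.mem_insert_of_mem hn)]
        simp
    refine ⟨1 - c v, ?_⟩
    rw [Finset.sum_congr rfl (fun a ha => by rw [hc a ha]), ← sub_add_sub_cancel i w v, h]
    module
  have hnn : ∀ n ∈ A, ∀ i ∈ N, 0 ≤ φ n (i - v) := by
    intro n hn i hi
    obtain ⟨c, hc, h⟩ := hw i hi
    rw [← sub_add_sub_cancel i w v, map_add, hφw n hn, add_zero, h, map_sum]
    refine Finset.sum_nonneg fun m hm => ?_
    rw [map_smul, hφ n hn m hm, smul_eq_mul]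
    exact mul_nonneg (hc m hm) (by split_ifs <;> norm_num)
  have hexpb : ∀ i ∈ N, ∃ t : ℝ, i - v =
      ∑ a ∈ A, (φ a (i - v) / φ a (b a - v)) • (b a - v) + t • (w - v) := by
    intro i hi
    obtain ⟨t, ht⟩ := hexp i hi
    have h1 : ∀ a ∈ A, ∃ s : ℝ, b a - v = φ a (b a - v) • (a - w) + s • (w - v) := by
      intro a ha
      obtain ⟨s, hs⟩ := hexp (b a) (hbN a ha)
      refine ⟨s, ?_⟩
      rw [Finset.sum_eq_single_of_mem a ha (fun n hn hne => by rw [hbzero a ha n hn hne, zero_smul])] at hs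
      exact hs
    choose! s hs using h1
    refine ⟨t - ∑ a ∈ A, (φ a (i - v) / φ a (b a - v)) * s a, ?_⟩
    have h2 : ∀ a ∈ A, (φ a (i - v) / φ a (b a - v)) • (b a - v) =
        φ a (i - v) • (a - w) + ((φ a (i - v) / φ a (b a - v)) * s a) • (w - v) := by
      intro a ha
      have hp := (hbpos a ha).ne'
      set p := φ a (b a - v)
      rw [hs a ha, smul_add, smul_smul, smul_smul, div_mul_cancel₀ _ hp]
    rw [Finset.sum_congr rfl h2, Finset.sum_add_distrib, ← Finset.sum_smul, sub_smul, add_assoc,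
      add_sub_cancel]
    exact ht
  have hZmem : ∀ i, i ∈ N \ insert w (A.image b) ↔ i ∈ N ∧ i ≠ w ∧ ∀ a ∈ A, b a ≠ i := by
    intro i; simp
  refine ⟨N \ insert w (A.image b), Finset.sdiff_subset, by simp, ?_, ?_, ?_⟩
  · have h1 : insert w (A.image b) ⊆ N := by
      rw [Finset.insert_subset_iff, Finset.image_subset_iff]
      exact ⟨hwN, hbN⟩
    have h2 : (insert w (A.image b)).card = A.card + 1 := by
      rw [Finset.card_insert_of_notMem (by simpa using hbw), Finset.card_image_of_injOn]
      exact fun a ha a' ha' h => hbinj a ha a' ha' h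
    rw [← h2, Finset.card_sdiff_add_card_eq_card h1]
  · intro z hz
    rw [hZmem] at hz
    obtain ⟨hzN, hzw, hzb⟩ := hz
    obtain ⟨t, ht⟩ := hexpb z hzN
    let κ : E → ℝ := fun a => φ a (z - v) / φ a (b a - v)
    have hκ : ∀ a ∈ A, 0 ≤ κ a := fun a ha => div_nonneg (hnn a ha z hzN) (hbpos a ha).le
    let r : E → ℝ := fun i => (if i = z then 1 else 0) - ∑ a ∈ A, (if i = b a then κ a else 0) -
      (if i = w then t else 0)
    have hrdep : r ∈ dependences N v := by
      change ∑ i ∈ N, r i • (i - v) = 0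
      simp only [r, sub_smul, Finset.sum_sub_distrib, Finset.sum_smul, ite_smul, zero_smul, one_smul,
        Finset.sum_ite_eq', hzN, hwN, if_true]
      rw [Finset.sum_comm, Finset.sum_congr rfl (g := fun a => κ a • (b a - v))]
      · rw [sub_eq_zero, sub_eq_iff_eq_add']; exact ht
      · intro a ha
        rw [Finset.sum_ite_eq', if_pos (hbN a ha)]
    have hrz : r z = 1 := by
      simp only [r, if_true, if_neg hzw]
      rw [Finset.sum_eq_zero (fun a ha => if_neg (hzb a ha).symm)]
      norm_num
    have hrb : ∀ i ∈ N, i ∉ N \ insert w (A.image b) → i ≠ w → r i ≤ 0 := by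
      intro i hi hiZ hiw
      rw [hZmem] at hiZ
      have hiz : i ≠ z := by
        rintro rfl; exact hiZ ⟨hzN, hzw, hzb⟩
      simp only [r, if_neg hiz, if_neg hiw, zero_sub, sub_zero, Left.neg_nonpos_iff]
      exact Finset.sum_nonneg fun a ha => by split_ifs; exacts [hκ a ha, le_rfl]
    have hry : ∀ y ∈ N \ insert w (A.image b), y ≠ z → r y = 0 := by
      intro y hy hyz
      rw [hZmem] at hy
      simp only [r, if_neg hyz, if_neg hy.2.1]
      rw [Finset.sum_eq_zero (fun a ha => if_neg (hy.2.2 a ha).symm)]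
      norm_num
    refine ⟨r, hrdep, hrz, hry, ?_, hrb⟩
    by_contra hcon
    refine hmin z hzN ⟨fun i => - r i, fun i hi => ?_, ?_⟩
    · rw [Finset.mem_erase] at hi
      rw [Left.nonneg_neg_iff]
      by_cases hiw : i = w
      · rw [hiw]; exact not_lt.mp hcon
      by_cases hiZ : i ∈ N \ insert w (A.image b)
      · exact (hry i hiZ hi.1).le
      · exact hrb i hi.2 hiZ hiw
    · have h1 : ∑ i ∈ N, r i • (i - v) = 0 := hrdep
      rw [← Finset.add_sum_erase _ _ hzN, hrz, one_smul] at h1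
      rw [eq_neg_of_add_eq_zero_left h1, ← Finset.sum_neg_distrib]
      exact Finset.sum_congr rfl fun i _ => (neg_smul _ _).symm
  · intro l hl hlZ
    have hl' : ∑ i ∈ N, l i • (i - v) = 0 := hl
    have hlb : ∀ a ∈ A, l (b a) = 0 := by
      intro a ha
      have h1 := congrArg (φ a) hl'
      rw [map_sum, map_zero, Finset.sum_eq_single_of_mem (b a) (hbN a ha), map_smul, smul_eq_mul] at h1
      · exact (mul_eq_zero.mp h1).resolve_right (hbpos a ha).ne'
      · intro i hi hib
        rw [map_smul, smul_eq_mul]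
        by_cases hiw : i = w
        · rw [hiw, hφw a ha, mul_zero]
        by_cases hiZ : i ∈ N \ insert w (A.image b)
        · rw [hlZ i hiZ, zero_mul]
        · rw [hZmem] at hiZ
          push Not at hiZ
          obtain ⟨a', ha', rfl⟩ := hiZ hi hiw
          rw [hbzero a' ha' a ha (by rintro rfl; exact hib rfl), mul_zero]
    have hne : ∀ i ∈ N, i ≠ w → l i = 0 := by
      intro i hi hiw
      by_cases hiZ : i ∈ N \ insert w (A.image b)
      · exact hlZ i hiZ
      · rw [hZmem] at hiZ
        push Not at hiZ
        obtain ⟨a', ha', rfl⟩ := hiZ hi hiw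
        exact hlb a' ha'
    intro i hi
    by_cases hiw : i = w
    · subst hiw
      rw [Finset.sum_eq_single_of_mem i hi (fun j hj hji => by rw [hne j hj hji, zero_smul])] at hl'
      exact (smul_eq_zero.mp hl').resolve_right (sub_ne_zero.mpr hwv)
    · exact hne i hi hiw

theorem IsExtreme.mem_of_sum_mem {E : Type*} [AddCommGroup E] [Module ℝ E] {P F : Set E}
    (hF : IsExtreme ℝ P F) (hP : Convex ℝ P) {t : Finset E} {c : E → ℝ} (hc : ∀ i ∈ t, 0 ≤ c i)
    (hc1 : ∑ i ∈ t, c i = 1) (htP : ∀ i ∈ t, i ∈ P) (hmem : ∑ i ∈ t, c i • i ∈ F) {j : E} (hj : j ∈ t)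
    (hcj : 0 < c j) : j ∈ F := by
  classical
  rw [← Finset.add_sum_erase _ _ hj] at hmem hc1
  have hc' : ∀ i ∈ t.erase j, 0 ≤ c i := fun i hi => hc i (Finset.mem_of_mem_erase hi)
  rcases (Finset.sum_nonneg hc').eq_or_lt with h | h
  · have h0 := (Finset.sum_eq_zero_iff_of_nonneg hc').mp h.symm
    rw [Finset.sum_eq_zero (fun i hi => by rw [h0 i hi, zero_smul]), add_zero] at hmem
    rw [← h, add_zero] at hc1
    rwa [hc1, one_smul] at hmem
  · have hp : (t.erase j).centerMass c id ∈ P :=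
      hP.centerMass_mem hc' h fun i hi => htP i (Finset.mem_of_mem_erase hi)
    refine hF.left_mem_of_mem_openSegment (htP j hj) hp hmem ⟨c j, ∑ i ∈ t.erase j, c i, hcj, h, hc1, ?_⟩
    rw [Finset.centerMass, smul_smul, mul_inv_cancel₀ h.ne', one_smul]
    rfl

section VertexCone

variable {E : Type*} [AddCommGroup E] [Module ℝ E]

open Classical in
/-- The neighbors of `v` in the graph of the polytope with vertex set `V`. -/
noncomputable def neighbors (V : Finset E) (v : E) : Finset E :=
  {u ∈ V | u ≠ v ∧ IsExtreme ℝ (convexHull ℝ (V : Set E)) (segment ℝ v u)}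

theorem mem_neighbors {V : Finset E} {v u : E} : u ∈ neighbors V v ↔
    u ∈ V ∧ u ≠ v ∧ IsExtreme ℝ (convexHull ℝ (V : Set E)) (segment ℝ v u) := by
  simp [neighbors]

theorem notMem_neighbors_self (V : Finset E) (v : E) : v ∉ neighbors V v := by
  simp [mem_neighbors]

theorem mem_neighbors_comm {V : Finset E} {v u : E} (hv : v ∈ V) (h : u ∈ neighbors V v) :
    v ∈ neighbors V u := by
  rw [mem_neighbors] at h ⊢
  exact ⟨hv, h.2.1.symm, segment_symm ℝ v u ▸ h.2.2⟩

theorem eq_zero_of_sum_smul_sub_eq_zero [DecidableEq E] {V : Finset E} {v : E}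
    (hv : v ∈ (convexHull ℝ (V : Set E)).extremePoints ℝ) {c : E → ℝ} (hc : ∀ i ∈ V.erase v, 0 ≤ c i)
    (h : ∑ i ∈ V.erase v, c i • (i - v) = 0) : ∀ i ∈ V.erase v, c i = 0 := by
  rcases (Finset.sum_nonneg hc).eq_or_lt with h0 | h0
  · exact (Finset.sum_eq_zero_iff_of_nonneg hc).mp h0.symm
  · exfalso
    rw [(convex_convexHull ℝ _).mem_extremePoints_iff_mem_sdiff_convexHull_sdiff] at hv
    refine hv.2 ?_
    have h1 : (V.erase v).centerMass c id = v := by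
      simp only [smul_sub, Finset.sum_sub_distrib, ← Finset.sum_smul, sub_eq_zero] at h
      rw [Finset.centerMass]
      simp only [id]
      rw [h, smul_smul, inv_mul_cancel₀ h0.ne', one_smul]
    rw [← h1]
    convert Finset.centerMass_mem_convexHull (V.erase v) hc h0 (z := id) (fun i hi => ?_)
    rw [h1]
    rw [Finset.mem_erase] at hi
    exact ⟨subset_convexHull ℝ _ hi.2, hi.1⟩

theorem inCone_erase_of_mem_convexHull [DecidableEq E] {V : Finset E} {v u : E} (hv : v ∈ V)
    (hu : u ∈ convexHull ℝ (V : Set E)) : InCone (V.erase v) v u := by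
  obtain ⟨c, hc, hc1, rfl⟩ := Finset.mem_convexHull'.mp hu
  refine ⟨c, fun i hi => hc i (Finset.mem_of_mem_erase hi), ?_⟩
  have h : ∑ i ∈ V, c i • (i - v) = ∑ i ∈ V, c i • i - v := by
    simp only [smul_sub, Finset.sum_sub_distrib, ← Finset.sum_smul, hc1, one_smul]
  rw [← h, ← Finset.add_sum_erase _ _ hv, sub_self, smul_zero, zero_add]

theorem InCone.trans {N M : Finset E} {v u : E} (h : InCone M v u) (hM : ∀ i ∈ M, InCone N v i) :
    InCone N v u := by
  obtain ⟨c, hc, hcu⟩ := h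
  choose! e he hei using hM
  refine ⟨fun j => ∑ i ∈ M, c i * e i j, fun j hj => Finset.sum_nonneg fun i hi =>
    mul_nonneg (hc i hi) (he i hi j hj), ?_⟩
  simp only [Finset.sum_smul, mul_smul]
  rw [Finset.sum_comm, hcu]
  exact Finset.sum_congr rfl fun i hi => by rw [← Finset.smul_sum, ← hei i hi]

theorem InCone.of_mem [DecidableEq E] {N : Finset E} {v u : E} (h : u ∈ N) : InCone N v u :=
  ⟨fun i => if i = u then 1 else 0, fun i _ => by dsimp only; split_ifs <;> norm_num, by simp [ite_smul, h]⟩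

theorem InCone.mono [DecidableEq E] {N M : Finset E} {v u : E} (h : InCone M v u) (hM : M ⊆ N) : InCone N v u :=
  h.trans fun _ hi => .of_mem (hM hi)

theorem isExtreme_segment_of_minimal [DecidableEq E] {V M : Finset E}
    (hV : (V : Set E) ⊆ (convexHull ℝ (V : Set E)).extremePoints ℝ) {v u : E} (hv : v ∈ V)
    (hM : M ⊆ V.erase v) (hgen : ∀ x ∈ convexHull ℝ (V : Set E), InCone M v x) (hu : u ∈ M)
    (hmin : ¬ InCone (M.erase u) v u) :
    IsExtreme ℝ (convexHull ℝ (V : Set E)) (segment ℝ v u) := by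
  have huV := Finset.mem_erase.mp (hM hu)
  have hvP := subset_convexHull ℝ (V : Set E) hv
  have huP := subset_convexHull ℝ (V : Set E) huV.2
  refine ⟨(convex_convexHull ℝ _).segment_subset hvP huP, ?_⟩
  rintro p hp q hq x hx ⟨α, β, hα, hβ, hαβ, rfl⟩
  rw [segment_eq_image'] at hx
  obtain ⟨s, hs, hsx⟩ := hx
  obtain ⟨a, ha, hpa⟩ := hgen p hp
  obtain ⟨b, hb, hqb⟩ := hgen q hq
  have key : ∑ i ∈ M, (α * a i + β * b i) • (i - v) = s • (u - v) := by
    have h1 : s • (u - v) = α • (p - v) + β • (q - v) := by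
      have h2 : s • (u - v) = α • p + β • q - v := by
        rw [← hsx]; exact (add_sub_cancel_left _ _).symm
      rw [h2, show β = 1 - α by linarith]
      module
    rw [h1, hpa, hqb, Finset.smul_sum, Finset.smul_sum, ← Finset.sum_add_distrib]
    exact Finset.sum_congr rfl fun i _ => by module
  have hnn : ∀ i ∈ M, 0 ≤ α * a i + β * b i := fun i hi =>
    add_nonneg (mul_nonneg hα.le (ha i hi)) (mul_nonneg hβ.le (hb i hi))
  rw [← Finset.add_sum_erase _ _ hu] at key
  have hκ : s ≤ α * a u + β * b u := by
    by_contra! hκ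
    have hpos : 0 < s - (α * a u + β * b u) := sub_pos.mpr hκ
    refine hmin ⟨fun i => (s - (α * a u + β * b u))⁻¹ * (α * a i + β * b i), fun i hi =>
      mul_nonneg (inv_nonneg.mpr hpos.le) (hnn i (Finset.mem_of_mem_erase hi)), ?_⟩
    simp only [mul_smul]
    rw [← Finset.smul_sum, eq_inv_smul_iff₀ hpos.ne', sub_smul, ← key]
    simp [add_smul, mul_smul]
  have hzero : ∀ i ∈ M.erase u, a i = 0 := by
    intro i hi
    let c : E → ℝ := fun j => if j ∈ M then (if j = u then α * a u + β * b u - s else α * a j + β * b j) else 0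
    have hc : ∀ j ∈ V.erase v, 0 ≤ c j := by
      intro j _
      dsimp only [c]
      split_ifs with h1 h2
      · linarith
      · exact hnn j h1
      · exact le_rfl
    have hsum : ∑ j ∈ V.erase v, c j • (j - v) = 0 := by
      rw [← Finset.sum_subset hM (fun j _ hj => by simp [c, hj]), ← Finset.add_sum_erase _ _ hu,
        Finset.sum_congr rfl (g := fun j => (α * a j + β * b j) • (j - v))]
      · simp only [c, hu, if_true]
        rw [sub_smul, ← key]
        abel
      · intro j hj
        rw [Finset.mem_erase] at hj
        simp [c, hj.1, hj.2]
    have h0 := eq_zero_of_sum_smul_sub_eq_zero (hV hv) hc hsum i (hM (Finset.mem_of_mem_erase hi))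
    rw [Finset.mem_erase] at hi
    simp only [c, hi.1, hi.2, if_true, if_false] at h0
    have h1 := mul_nonneg hα.le (ha i hi.2)
    have h2 := mul_nonneg hβ.le (hb i hi.2)
    exact (mul_eq_zero.mp (by linarith : α * a i = 0)).resolve_left hα.ne'
  rw [← Finset.add_sum_erase _ _ hu, Finset.sum_eq_zero (fun i hi => by rw [hzero i hi, zero_smul]),
    add_zero] at hpa
  rw [segment_eq_image']
  refine ⟨a u, ⟨ha u hu, ?_⟩, ?_⟩
  · by_contra! h1
    have hmem : u ∈ openSegment ℝ v p := by
      rw [openSegment_eq_image']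
      have h0 : 0 < a u := by linarith
      refine ⟨(a u)⁻¹, ⟨inv_pos.mpr h0, inv_lt_one_of_one_lt₀ h1⟩, ?_⟩
      dsimp only
      rw [hpa, smul_smul, inv_mul_cancel₀ h0.ne', one_smul, add_sub_cancel]
    exact huV.1 ((hV huV.2).2 hvP hp hmem).symm
  · dsimp only
    rw [← hpa, add_sub_cancel]

theorem inCone_neighbors [DecidableEq E] {V : Finset E}
    (hV : (V : Set E) ⊆ (convexHull ℝ (V : Set E)).extremePoints ℝ) {v u : E} (hv : v ∈ V)
    (hu : u ∈ convexHull ℝ (V : Set E)) : InCone (neighbors V v) v u := by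
  obtain ⟨M, ⟨hM, hgen⟩, hmin⟩ := exists_minimal_of_wellFoundedLT
    (fun M : Finset E => M ⊆ V.erase v ∧ ∀ x ∈ convexHull ℝ (V : Set E), InCone M v x)
    ⟨V.erase v, subset_rfl, fun x hx => inCone_erase_of_mem_convexHull hv hx⟩
  refine (hgen u hu).mono fun i hi => ?_
  have hiV := Finset.mem_erase.mp (hM hi)
  refine mem_neighbors.mpr ⟨hiV.2, hiV.1, isExtreme_segment_of_minimal hV hv hM hgen hi fun hcon => ?_⟩
  refine Finset.notMem_erase i M (hmin (y := M.erase i) ⟨(Finset.erase_subset _ _).trans hM, fun x hx => ?_⟩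
    (Finset.erase_subset _ _) hi)
  refine (hgen x hx).trans fun j hj => ?_
  by_cases hji : j = i
  · exact hji ▸ hcon
  · exact .of_mem (Finset.mem_erase.mpr ⟨hji, hj⟩)

theorem not_inCone_erase_neighbors [DecidableEq E] {V : Finset E}
    (hV : (V : Set E) ⊆ (convexHull ℝ (V : Set E)).extremePoints ℝ) {v z : E} (hv : v ∈ V)
    (hz : z ∈ neighbors V v) : ¬ InCone ((neighbors V v).erase z) v z := by
  rintro ⟨c, hc, h⟩
  have hz' := mem_neighbors.mp hz
  set N := (neighbors V v).erase z with hN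
  have hvN : v ∉ N := fun hv' => notMem_neighbors_self V v (Finset.mem_of_mem_erase hv')
  have hC : 0 ≤ ∑ i ∈ N, c i := Finset.sum_nonneg hc
  obtain ⟨j, hj, hcj⟩ : ∃ j ∈ N, 0 < c j := by
    by_contra! hcon
    rw [Finset.sum_eq_zero (fun i hi => by rw [le_antisymm (hcon i hi) (hc i hi), zero_smul])] at h
    exact hz'.2.1 (sub_eq_zero.mp h)
  obtain ⟨ε, hε, hε1, hεC⟩ : ∃ ε : ℝ, 0 < ε ∧ ε ≤ 1 ∧ ε * ∑ i ∈ N, c i ≤ 1 :=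
    ⟨(1 + ∑ i ∈ N, c i)⁻¹, by positivity, inv_le_one_of_one_le₀ (by linarith), by
      rw [inv_mul_le_one₀ (by positivity)]; linarith⟩
  let e : E → ℝ := fun i => if i = v then 1 - ε * ∑ i ∈ N, c i else ε * c i
  have he : ∀ i ∈ N, e i = ε * c i := fun i hi => if_neg (by rintro rfl; exact hvN hi)
  have hsum : ∑ i ∈ insert v N, e i = 1 := by
    rw [Finset.sum_insert hvN, Finset.sum_congr rfl he, ← Finset.mul_sum]
    simp [e]
  have hpt : ∑ i ∈ insert v N, e i • i = v + ε • (z - v) := by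
    rw [Finset.sum_insert hvN, Finset.sum_congr rfl (fun i hi => by rw [he i hi]), h]
    simp only [e, if_true, smul_sub, Finset.sum_sub_distrib, mul_smul, ← Finset.sum_smul, ← Finset.smul_sum,
      sub_smul, one_smul]
    abel
  have hjV : j ∈ V := (mem_neighbors.mp (Finset.mem_of_mem_erase hj)).1
  have hjv : j ≠ v := (mem_neighbors.mp (Finset.mem_of_mem_erase hj)).2.1
  have hjseg : j ∈ segment ℝ v z := by
    refine hz'.2.2.mem_of_sum_mem (convex_convexHull ℝ _) (t := insert v N) (c := e) ?_ hsum ?_ ?_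
      (Finset.mem_insert_of_mem hj) (by rw [he j hj]; positivity)
    · intro i hi
      rcases Finset.mem_insert.mp hi with rfl | hi
      · simpa [e] using hεC
      · rw [he i hi]; exact mul_nonneg hε.le (hc i hi)
    · intro i hi
      refine subset_convexHull ℝ _ ?_
      rcases Finset.mem_insert.mp hi with rfl | hi
      · exact hv
      · exact (mem_neighbors.mp (Finset.mem_of_mem_erase hi)).1
    · rw [hpt, segment_eq_image']
      exact ⟨ε, ⟨hε.le, hε1⟩, rfl⟩
  rcases (mem_extremePoints_iff_forall_segment.mp (hV hjV)).2 v (subset_convexHull ℝ _ hv) z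
    (subset_convexHull ℝ _ hz'.1) hjseg with h1 | h1
  · exact hjv h1.symm
  · exact (Finset.mem_erase.mp hj).1 h1.symm

theorem finrank_vectorSpan_le_finrank_span_neighbors [FiniteDimensional ℝ E] {V : Finset E}
    (hV : (V : Set E) ⊆ (convexHull ℝ (V : Set E)).extremePoints ℝ) {v : E} (hv : v ∈ V) :
    Module.finrank ℝ (vectorSpan ℝ (convexHull ℝ (V : Set E))) ≤
      (Set.range fun n : neighbors V v => (n : E) - v).finrank ℝ := by
  classical
  refine Submodule.finrank_mono ?_
  rw [vectorSpan_eq_span_vsub_set_right ℝ (subset_convexHull ℝ (V : Set E) hv), Submodule.span_le]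
  rintro _ ⟨x, hx, rfl⟩
  obtain ⟨c, -, h⟩ := inCone_neighbors hV hv hx
  change x - v ∈ Submodule.span ℝ _
  rw [h]
  exact Submodule.sum_mem _ fun i hi => Submodule.smul_mem _ _ (Submodule.subset_span ⟨⟨i, hi⟩, rfl⟩)

theorem finrank_vectorSpan_le_card_neighbors [FiniteDimensional ℝ E] {V : Finset E}
    (hV : (V : Set E) ⊆ (convexHull ℝ (V : Set E)).extremePoints ℝ) {v : E} (hv : v ∈ V) :
    Module.finrank ℝ (vectorSpan ℝ (convexHull ℝ (V : Set E))) ≤ (neighbors V v).card := by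
  refine (finrank_vectorSpan_le_finrank_span_neighbors hV hv).trans ?_
  simpa using finrank_range_le_card (R := ℝ) fun n : neighbors V v => (n : E) - v

theorem exists_dependences_of_simple_neighbor [FiniteDimensional ℝ E] {V : Finset E}
    (hV : (V : Set E) ⊆ (convexHull ℝ (V : Set E)).extremePoints ℝ) {v w : E} (hv : v ∈ V)
    (hw : w ∈ neighbors V v)
    (hsimple : (neighbors V w).card = Module.finrank ℝ (vectorSpan ℝ (convexHull ℝ (V : Set E)))) :
    ∃ Z ⊆ neighbors V v, w ∉ Z ∧ Z.card + (neighbors V w).card = (neighbors V v).card ∧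
      (∀ z ∈ Z, ∃ r ∈ dependences (neighbors V v) v, r z = 1 ∧ (∀ y ∈ Z, y ≠ z → r y = 0) ∧ 0 < r w ∧
        ∀ i ∈ neighbors V v, i ∉ Z → i ≠ w → r i ≤ 0) ∧
      ∀ l ∈ dependences (neighbors V v) v, (∀ z ∈ Z, l z = 0) → ∀ i ∈ neighbors V v, l i = 0 := by
  classical
  have hw' := mem_neighbors.mp hw
  have hvw := mem_neighbors_comm hv hw
  have hli : LinearIndependent ℝ fun n : neighbors V w => (n : E) - w := by
    rw [linearIndependent_iff_card_le_finrank_span, Fintype.card_coe, hsimple]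
    exact finrank_vectorSpan_le_finrank_span_neighbors hV hw'.1
  have hins := Finset.insert_erase hvw
  have hnV : ∀ x y, x ∈ neighbors V y → x ∈ convexHull ℝ (V : Set E) := fun x y hx =>
    subset_convexHull ℝ _ (mem_neighbors.mp hx).1
  have hcard := Finset.card_erase_add_one hvw
  rw [← hcard]
  refine exists_dependences_of_simple (Finset.notMem_erase v _) hw'.2.1 hw ?_ ?_ ?_ ?_
  · rw [hins]; exact hli
  · rw [hins]; exact fun i hi => inCone_neighbors hV hw'.1 (hnV _ _ hi)
  · exact fun a ha => inCone_neighbors hV hv (hnV _ _ (Finset.mem_of_mem_erase ha))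
  · exact fun z hz => not_inCone_erase_neighbors hV hv hz

end VertexCone

theorem convexHull_extremePoints_of_finite {n : ℕ} (S : Finset (Fin n → ℝ)) :
    convexHull ℝ ((convexHull ℝ (S : Set (Fin n → ℝ))).extremePoints ℝ) = convexHull ℝ (S : Set (Fin n → ℝ)) := by
  have hfin : ((convexHull ℝ (S : Set (Fin n → ℝ))).extremePoints ℝ).Finite :=
    S.finite_toSet.subset extremePoints_convexHull_subset
  rw [← (hfin.isClosed_convexHull ℝ).closure_eq]
  exact closure_convexHull_extremePoints (S.finite_toSet.isCompact_convexHull ℝ) (convex_convexHull ℝ _)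

theorem IsExtreme.eq_convexHull_inter {E : Type*} [AddCommGroup E] [Module ℝ E] {V : Finset E} {F : Set E}
    (hF : IsExtreme ℝ (convexHull ℝ (V : Set E)) F) (hconv : Convex ℝ F) :
    F = convexHull ℝ ((V : Set E) ∩ F) := by
  classical
  refine Set.Subset.antisymm (fun x hx => ?_) (convexHull_min Set.inter_subset_right hconv)
  obtain ⟨c, hc, hc1, rfl⟩ := Finset.mem_convexHull'.mp (hF.subset hx)
  have hmem : ∀ i ∈ V, c i ≠ 0 → i ∈ F := fun i hi h0 =>
    hF.mem_of_sum_mem (convex_convexHull ℝ _) hc hc1 (fun j hj => subset_convexHull ℝ _ hj) hx hi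
      ((hc i hi).lt_of_ne h0.symm)
  have hsub : V.filter (fun i => c i ≠ 0) ⊆ V := Finset.filter_subset _ _
  have hz : ∀ i ∈ V, i ∉ V.filter (fun i => c i ≠ 0) → c i = 0 := fun i hi hni => by
    by_contra h; exact hni (Finset.mem_filter.mpr ⟨hi, h⟩)
  rw [← Finset.sum_subset hsub fun i hi hni => by rw [hz i hi hni, zero_smul]]
  refine (convex_convexHull ℝ _).sum_mem (fun i hi => hc i (hsub hi)) ?_ fun i hi => subset_convexHull ℝ _ ?_
  · rw [Finset.sum_subset hsub hz, hc1]
  · rw [Finset.mem_filter] at hi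
    exact ⟨hi.1, hmem i hi.1 hi.2⟩

theorem isEdge_iff_exists_segment {n : ℕ} {V : Finset (Fin n → ℝ)}
    (hV : (V : Set (Fin n → ℝ)) ⊆ (convexHull ℝ (V : Set (Fin n → ℝ))).extremePoints ℝ)
    {F : Set (Fin n → ℝ)} :
    IsEdge (convexHull ℝ (V : Set (Fin n → ℝ))) F ↔ ∃ a ∈ V, ∃ b ∈ neighbors V a, F = segment ℝ a b := by
  constructor
  · rintro ⟨hF, hconv, hdim⟩
    have hhull := hF.eq_convexHull_inter hconv
    have hnt : ((V : Set (Fin n → ℝ)) ∩ F).Nontrivial := by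
      by_contra hcon
      rw [Set.not_nontrivial_iff] at hcon
      have hsub : F.Subsingleton := by
        rw [hhull]
        rcases hcon.eq_empty_or_singleton with h | ⟨x, h⟩
        · rw [h, convexHull_empty]; exact Set.subsingleton_empty
        · rw [h, convexHull_singleton]; exact Set.subsingleton_singleton
      rw [adim, vectorSpan_of_subsingleton ℝ hsub, finrank_bot] at hdim
      exact zero_ne_one hdim
    obtain ⟨a, ha, b, hb, hab⟩ := hnt
    have hcol : Collinear ℝ F := collinear_iff_finrank_le_one.mpr hdim.le
    have hext : ∀ x ∈ V, ∀ y ∈ V, ∀ z ∈ V, Wbtw ℝ x y z → x = y ∨ z = y := fun x hx y hy z hz h =>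
      (mem_extremePoints_iff_forall_segment.mp (hV hy)).2 x (subset_convexHull ℝ _ hx) z
        (subset_convexHull ℝ _ hz) (mem_segment_iff_wbtw.mpr h)
    have hpair : (V : Set (Fin n → ℝ)) ∩ F = {a, b} := by
      refine Set.Subset.antisymm (fun c hc => ?_) (Set.insert_subset ha (Set.singleton_subset_iff.mpr hb))
      have hcol3 : Collinear ℝ {a, b, c} := hcol.subset (by
        rintro x (rfl | rfl | rfl)
        exacts [ha.2, hb.2, hc.2])
      rw [Set.mem_insert_iff, Set.mem_singleton_iff]
      rcases hcol3.wbtw_or_wbtw_or_wbtw with h | h | h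
      · exact (hext a ha.1 b hb.1 c hc.1 h).elim (fun h => absurd h hab) .inr
      · exact (hext b hb.1 c hc.1 a ha.1 h).elim (fun h => .inr h.symm) (fun h => .inl h.symm)
      · exact (hext c hc.1 a ha.1 b hb.1 h).elim .inl (fun h => absurd h.symm hab)
    rw [hpair, convexHull_pair] at hhull
    exact ⟨a, ha.1, b, mem_neighbors.mpr ⟨hb.1, hab.symm, hhull ▸ hF⟩, hhull⟩
  · rintro ⟨a, ha, b, hb, rfl⟩
    rw [mem_neighbors] at hb
    refine ⟨hb.2.2, convex_segment a b, ?_⟩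
    rw [adim, vectorSpan_segment, finrank_span_singleton]
    exact sub_ne_zero.mpr hb.2.1

/-- The graph of the polytope with vertex set `V`. -/
def polytopeGraph {E : Type*} [AddCommGroup E] [Module ℝ E] (V : Finset E) : SimpleGraph V where
  Adj a b := (b : E) ∈ neighbors V a
  symm := ⟨fun a _ h => mem_neighbors_comm a.2 h⟩
  loopless := ⟨fun a h => notMem_neighbors_self V a h⟩

theorem endpoints_eq_of_segment_eq {E : Type*} [AddCommGroup E] [Module ℝ E] {P : Set E} {a b c d : E}
    (ha : a ∈ P.extremePoints ℝ) (hb : b ∈ P.extremePoints ℝ) (hc : c ∈ P) (hd : d ∈ P)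
    (hab : a ≠ b) (h : segment ℝ a b = segment ℝ c d) : a = c ∧ b = d ∨ a = d ∧ b = c := by
  have h1 := (mem_extremePoints_iff_forall_segment.mp ha).2 c hc d hd (h ▸ left_mem_segment ℝ a b)
  have h2 := (mem_extremePoints_iff_forall_segment.mp hb).2 c hc d hd (h ▸ right_mem_segment ℝ a b)
  grind

theorem sum_card_neighbors_eq_two_mul_edges {n : ℕ} {V : Finset (Fin n → ℝ)}
    (hV : (V : Set (Fin n → ℝ)) ⊆ (convexHull ℝ (V : Set (Fin n → ℝ))).extremePoints ℝ) :
    ∑ v ∈ V, (neighbors V v).card = 2 * f₁ (convexHull ℝ (V : Set (Fin n → ℝ))) := by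
  classical
  have hdeg : ∀ v : V, (polytopeGraph V).degree v = (neighbors V v).card := by
    intro v
    rw [← SimpleGraph.card_neighborFinset_eq_degree]
    refine Finset.card_bij (fun u _ => (u : Fin n → ℝ)) (fun u hu => ?_)
      (fun _ _ _ _ h => Subtype.ext h) fun u hu => ?_
    · exact (SimpleGraph.mem_neighborFinset _ _ _).mp hu
    · exact ⟨⟨u, (mem_neighbors.mp hu).1⟩, (SimpleGraph.mem_neighborFinset _ _ _).mpr hu, rfl⟩
  rw [← Finset.sum_coe_sort V, ← Finset.sum_congr rfl (fun v _ => hdeg v),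
    SimpleGraph.sum_degrees_eq_twice_card_edges]
  congr 1
  let f : Sym2 V → Set (Fin n → ℝ) := Sym2.lift ⟨fun a b => segment ℝ (a : Fin n → ℝ) b,
    fun a b => segment_symm ℝ _ _⟩
  have himg : {F | IsEdge (convexHull ℝ (V : Set (Fin n → ℝ))) F} = f '' (polytopeGraph V).edgeSet := by
    ext F
    rw [Set.mem_ofPred_eq, isEdge_iff_exists_segment hV]
    constructor
    · rintro ⟨a, ha, b, hb, rfl⟩
      exact ⟨s(⟨a, ha⟩, ⟨b, (mem_neighbors.mp hb).1⟩), hb, rfl⟩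
    · rintro ⟨e, he, rfl⟩
      induction e with
      | h a b => exact ⟨a, a.2, b, he, rfl⟩
  rw [f₁, himg, Set.InjOn.ncard_image, ← SimpleGraph.coe_edgeFinset, Set.ncard_coe_finset]
  intro e he e' he' h
  induction e with
  | h a b =>
    induction e' with
    | h c d =>
      have hab : (a : Fin n → ℝ) ≠ b := fun hab => (mem_neighbors.mp he).2.1 hab.symm
      rw [Sym2.eq_iff]
      exact (endpoints_eq_of_segment_eq (hV a.2) (hV b.2) (subset_convexHull ℝ _ c.2)
        (subset_convexHull ℝ _ d.2) hab h).imp (And.imp Subtype.ext Subtype.ext)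
        (And.imp Subtype.ext Subtype.ext)

section Excess

variable {E : Type*} [AddCommGroup E] [Module ℝ E] [FiniteDimensional ℝ E] {V : Finset E} {d : ℕ}

theorem exists_two_nonsimple_neighbors
    (hV : (V : Set E) ⊆ (convexHull ℝ (V : Set E)).extremePoints ℝ)
    (hd : Module.finrank ℝ (vectorSpan ℝ (convexHull ℝ (V : Set E))) = d) (h4 : 4 < d)
    {v : E} (hv : v ∈ V) (hdeg : (neighbors V v).card = d + 1) :
    ∃ a ∈ V, ∃ b ∈ V, a ≠ v ∧ b ≠ v ∧ a ≠ b ∧ (neighbors V a).card ≠ d ∧ (neighbors V b).card ≠ d := by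
  classical
  by_contra! hcon
  have hS : 5 ≤ ((neighbors V v).filter fun w => (neighbors V w).card = d).card := by
    have h1 : ((neighbors V v).filter fun w => ¬ (neighbors V w).card = d).card ≤ 1 := by
      refine Finset.card_le_one.mpr fun a ha b hb => ?_
      rw [Finset.mem_filter, mem_neighbors] at ha hb
      by_contra hab
      exact hb.2 (hcon a ha.1.1 b hb.1.1 ha.1.2.1 hb.1.2.1 hab ha.2)
    have h2 := Finset.card_filter_add_card_filter_not (s := neighbors V v) fun w => (neighbors V w).card = d
    omega
  refine not_codim_one (neighbors V v) _ (dependences (neighbors V v) v) (Finset.filter_subset _ _) hS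
    fun w hw => ?_
  rw [Finset.mem_filter] at hw
  obtain ⟨Z, hZN, hwZ, hcard, hr, huniq⟩ := exists_dependences_of_simple_neighbor hV hv hw.1 (hw.2.trans hd.symm)
  obtain ⟨z, rfl⟩ := Finset.card_eq_one.mp (by omega : Z.card = 1)
  obtain ⟨r, hrL, hrz, -, hrw, hneg⟩ := hr z (Finset.mem_singleton_self z)
  refine ⟨z, hZN (Finset.mem_singleton_self z), r, hrL, hrw, by rw [hrz]; exact one_pos,
    fun i hi hiw hiz => hneg i hi (by simpa using hiz) hiw, fun l hl => ⟨l z, fun i hi => ?_⟩⟩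
  have := huniq (fun i => l i - l z * r i) ?_ (by simp [hrz]) i hi
  · exact sub_eq_zero.mp this
  · simp only [dependences, Set.mem_ofPred_eq] at hl hrL ⊢
    simp only [sub_smul, mul_smul, Finset.sum_sub_distrib, ← Finset.smul_sum, hl, hrL, smul_zero, sub_zero]

theorem exists_nonsimple_neighbor
    (hV : (V : Set E) ⊆ (convexHull ℝ (V : Set E)).extremePoints ℝ)
    (hd : Module.finrank ℝ (vectorSpan ℝ (convexHull ℝ (V : Set E))) = d) (h4 : 4 < d)
    {v : E} (hv : v ∈ V) (hdeg : (neighbors V v).card = d + 2) :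
    ∃ a ∈ V, a ≠ v ∧ (neighbors V a).card ≠ d := by
  classical
  by_contra! hcon
  refine not_codim_two (neighbors V v) (dependences (neighbors V v) v) (by omega) fun w hw => ?_
  have hw' := mem_neighbors.mp hw
  obtain ⟨Z, hZN, hwZ, hcard, hr, huniq⟩ := exists_dependences_of_simple_neighbor hV hv hw
    ((hcon w hw'.1 hw'.2.1).trans hd.symm)
  have hwdeg := hcon w hw'.1 hw'.2.1
  obtain ⟨z, z', hzz, rfl⟩ := Finset.card_eq_two.mp (by omega : Z.card = 2)
  have hz : z ∈ ({z, z'} : Finset E) := by simp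
  have hz' : z' ∈ ({z, z'} : Finset E) := by simp
  obtain ⟨r, hrL, hrz, hrz', hrw, hneg⟩ := hr z hz
  obtain ⟨r', hrL', hr'z', hr'z, hrw', hneg'⟩ := hr z' hz'
  replace hrz' := hrz' z' hz' hzz.symm
  replace hr'z := hr'z z hz hzz
  refine ⟨z, hZN hz, z', hZN hz', r, hrL, r', hrL', hrz, hrz', hr'z, hr'z', hrw, hrw',
    fun i hi hiw hiz hiz' => ?_, fun l hl i hi => ?_⟩
  · have hiZ : i ∉ ({z, z'} : Finset E) := by simp [hiz, hiz']
    exact ⟨hneg i hi hiZ hiw, hneg' i hi hiZ hiw⟩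
  have := huniq (fun i => l i - (l z * r i + l z' * r' i)) ?_ (by simp [hrz, hrz', hr'z, hr'z']) i hi
  · exact sub_eq_zero.mp this
  · simp only [dependences, Set.mem_ofPred_eq] at hl hrL hrL' ⊢
    simp only [sub_smul, add_smul, mul_smul, Finset.sum_sub_distrib, Finset.sum_add_distrib,
      ← Finset.smul_sum, hl, hrL, hrL', smul_zero, sub_zero, add_zero]

theorem sum_card_neighbors_notMem_Ioc
    (hV : (V : Set E) ⊆ (convexHull ℝ (V : Set E)).extremePoints ℝ)
    (hd : Module.finrank ℝ (vectorSpan ℝ (convexHull ℝ (V : Set E))) = d) (h4 : 4 < d) :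
    ∑ v ∈ V, (neighbors V v).card ∉ Set.Ioc (d * V.card) (d * V.card + 2) := by
  classical
  rintro ⟨hlow, hup⟩
  have hle : ∀ v ∈ V, d ≤ (neighbors V v).card := fun v hv =>
    hd ▸ finrank_vectorSpan_le_card_neighbors hV hv
  have hsplit : ∑ v ∈ V, (neighbors V v).card = d * V.card + ∑ v ∈ V, ((neighbors V v).card - d) := by
    rw [mul_comm, ← smul_eq_mul, ← Finset.sum_const, ← Finset.sum_add_distrib]
    exact Finset.sum_congr rfl fun v hv => by have := hle v hv; omega
  rw [hsplit] at hlow hup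
  have hsum : ∑ v ∈ V, ((neighbors V v).card - d) ≤ 2 := by omega
  obtain ⟨v, hv, hpos⟩ := Finset.exists_lt_of_sum_lt (s := V) (f := fun _ => 0)
    (g := fun v => (neighbors V v).card - d) (by simp only [Finset.sum_const_zero]; omega)
  have hbound : ∀ T ⊆ V, ∑ v ∈ T, ((neighbors V v).card - d) ≤ 2 := fun T hT =>
    (Finset.sum_le_sum_of_subset hT).trans hsum
  have h1 := hbound {v} (by simpa using hv)
  rw [Finset.sum_singleton] at h1
  have hcases : (neighbors V v).card = d + 1 ∨ (neighbors V v).card = d + 2 := by omega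
  rcases hcases with h | h
  · obtain ⟨a, ha, b, hb, hav, hbv, hab, hda, hdb⟩ := exists_two_nonsimple_neighbors hV hd h4 hv h
    have h2 := hbound {v, a, b} (by
      intro x; simp only [Finset.mem_insert, Finset.mem_singleton]; rintro (rfl | rfl | rfl) <;> assumption)
    rw [Finset.sum_insert (by simp [hav.symm, hbv.symm]), Finset.sum_pair hab] at h2
    have := hle a ha
    have := hle b hb
    omega
  · obtain ⟨a, ha, hav, hda⟩ := exists_nonsimple_neighbor hV hd h4 hv h
    have h2 := hbound {v, a} (by
      intro x; simp only [Finset.mem_insert, Finset.mem_singleton]; rintro (rfl | rfl) <;> assumption)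
    rw [Finset.sum_pair hav.symm] at h2
    have := hle a ha
    omega

end Excess

/-- For a `d`-polytope with `d > 4`, `f₁ ≠ ⌊(d/2)·f₀ + 1⌋`; equivalently the excess
degree `2·f₁ - d·f₀` is never `1` or `2`. -/
theorem stmt1 (d : ℕ) (hd : 4 < d) (n : ℕ) (P : Set (Fin n → ℝ))
    (hP : IsDPolytope d P) :
    f₁ P ≠ d * f₀ P / 2 + 1 ∧
    2 * (f₁ P : ℤ) - (d : ℤ) * (f₀ P : ℤ) ≠ 1 ∧
    2 * (f₁ P : ℤ) - (d : ℤ) * (f₀ P : ℤ) ≠ 2 := by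
  obtain ⟨⟨S, rfl⟩, hdim⟩ := hP
  set P := convexHull ℝ (S : Set (Fin n → ℝ)) with hP
  have hfin : (P.extremePoints ℝ).Finite := S.finite_toSet.subset extremePoints_convexHull_subset
  obtain ⟨V, hV⟩ := hfin.exists_finset_coe
  have hPV : P = convexHull ℝ (V : Set (Fin n → ℝ)) := by
    rw [hV, hP, convexHull_extremePoints_of_finite]
  have hf₀ : f₀ P = V.card := by rw [f₀, ← hV, Set.ncard_coe_finset]
  have hVP : (V : Set (Fin n → ℝ)) ⊆ (convexHull ℝ (V : Set (Fin n → ℝ))).extremePoints ℝ := by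
    rw [← hPV, hV]
  have hsum := sum_card_neighbors_eq_two_mul_edges hVP
  have hmain := sum_card_neighbors_notMem_Ioc hVP (d := d) (by rw [← hPV]; exact hdim) hd
  rw [hsum, ← hPV, Set.mem_Ioc, ← hf₀] at hmain
  zify at hmain
  generalize hx : d * f₀ P = x at *
  have hx' : (d : ℤ) * (f₀ P : ℤ) = x := by rw [← hx]; push_cast; rfl
  rw [hx'] at hmain ⊢
  omega
end

section
/- None of the pairs (8,24), (9,27), (9,29), (10,30), (10,32), (10,34), (11,33) belongs to E^6, and moreover (f0+1, ⌊(7/2)·f0 + 1⌋) ∉ E^6 for f0 = 7, 8, 9 (i.e., the pairs (8,25), (9,29), (10,32) are not in E^6). -/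
open Set

/-- No point of the family is a convex combination of the other points. -/
def ConvexlyIndependent {W E : Type*} [Fintype W] [AddCommGroup E] [Module ℝ E]
    (p : W → E) : Prop :=
  ∀ (a : W) (c : W → ℝ), (∀ u, 0 ≤ c u) → ∑ u, c u • p u = (∑ u, c u) • p a →
    ∀ u, u ≠ a → c u = 0

/-- The segment joining `p a` and `p b` is a proper edge of the convex hull of the family `p`,
stated through convex combinations (with homogeneous weights). -/
def EdgePair {W E : Type*} [Fintype W] [AddCommGroup E] [Module ℝ E]
    (p : W → E) (a b : W) : Prop :=
  a ≠ b ∧ ∀ (c : W → ℝ) (s t : ℝ), (∀ u, 0 ≤ c u) → 0 ≤ s → 0 ≤ t → ∑ u, c u = s + t →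
    ∑ u, c u • p u = s • p a + t • p b → ∀ u, u ≠ a → u ≠ b → c u = 0

section Families

variable {W E F : Type*} [Fintype W] [AddCommGroup E] [Module ℝ E] [AddCommGroup F] [Module ℝ F]

theorem EdgePair.symm {p : W → E} {a b : W} (h : EdgePair p a b) : EdgePair p b a :=
  ⟨h.1.symm, fun c s t hc hs ht hst hp u hub hua =>
    h.2 c t s hc ht hs (by rw [hst, add_comm]) (by rw [hp, add_comm]) u hua hub⟩

theorem sum_smul_sub (p : W → E) (a : W) (c : W → ℝ) :
    ∑ u, c u • (p u - p a) = ∑ u, c u • p u - (∑ u, c u) • p a := by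
  simp only [smul_sub, Finset.sum_sub_distrib, Finset.sum_smul]

theorem ConvexlyIndependent.eq_zero_of_sum_sub {p : W → E} (hp : ConvexlyIndependent p) {a : W}
    {c : W → ℝ} (hc : ∀ u, 0 ≤ c u) (h : ∑ u, c u • (p u - p a) = 0) :
    ∀ u, u ≠ a → c u = 0 :=
  hp a c hc (by rw [sum_smul_sub, sub_eq_zero] at h; exact h)

/-- Three distinct points of a convexly independent family are not collinear. -/
theorem ConvexlyIndependent.not_collinear {p : W → E} (hp : ConvexlyIndependent p) {a b e : W}
    (hab : a ≠ b) (hae : a ≠ e) (hbe : b ≠ e) (r : ℝ) : p e - p a ≠ r • (p b - p a) := by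
  classical
  intro h
  have key : ∀ x y z : W, x ≠ y → x ≠ z → y ≠ z → ∀ s t : ℝ, 0 ≤ s → 0 ≤ t → 0 < s + t →
      s • p y + t • p z = (s + t) • p x → False := by
    intro x y z hxy hxz hyz s t hs ht hst hxyz
    have h1 := hp x (fun u => (if u = y then s else 0) + (if u = z then t else 0))
      (fun u => by positivity)
      (by simpa [add_smul, Finset.sum_add_distrib, ite_smul] using hxyz)
    have h2 := h1 y hxy.symm
    have h3 := h1 z hxz.symm
    simp [hyz, hyz.symm] at h2 h3
    linarith
  have he : p e = p a + r • (p b - p a) := by rw [← h]; abel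
  rcases lt_or_ge r 0 with hr | hr
  · refine key a e b hae hab hbe.symm 1 (-r) (by norm_num) (by linarith) (by linarith) ?_
    rw [he]; module
  rcases le_or_gt r 1 with hr1 | hr1
  · refine key e a b hae.symm hbe.symm hab (1 - r) r (by linarith) hr (by linarith) ?_
    rw [he]; module
  · refine key b a e hab.symm hbe hae (r - 1) 1 (by linarith) (by norm_num) (by linarith) ?_
    rw [he]; module

theorem sum_ite_smul [DecidableEq W] (g : W → E) (f : W → ℝ) (w : W) (r : ℝ) :
    ∑ x, (if x = w then r else f x) • g x = ∑ x, f x • g x + (r - f w) • g w := by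
  have : ∀ x, (if x = w then r else f x) • g x
      = f x • g x + (if x = w then (r - f w) • g w else 0) := by
    intro x
    split_ifs with h
    · subst h; module
    · simp
  simp [this, Finset.sum_add_distrib]

/-- The cone of a convexly independent family at one of its points is spanned by the edges at
that point. -/
theorem ConvexlyIndependent.exists_edge_coeff {p : W → E} (hp : ConvexlyIndependent p)
    (a b : W) : ∃ c : W → ℝ, (∀ u, 0 ≤ c u) ∧ (∀ u, c u ≠ 0 → EdgePair p a u) ∧
      p b - p a = ∑ u, c u • (p u - p a) := by
  classical
  let Gen : Finset W → Prop := fun U => a ∉ U ∧ ∀ b, ∃ c : W → ℝ, (∀ u, 0 ≤ c u) ∧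
    (∀ u, u ∉ U → c u = 0) ∧ p b - p a = ∑ u, c u • (p u - p a)
  have hG : Gen (Finset.univ.erase a) := by
    refine ⟨by simp, fun b => ?_⟩
    by_cases hb : b = a
    · exact ⟨0, by simp, by simp, by simp [hb]⟩
    · refine ⟨Pi.single b 1, fun u => ?_, fun u hu => ?_, ?_⟩
      · by_cases h : u = b
        · subst h; simp
        · simp [h]
      · have : u = a := by simpa using hu
        subst this
        simp [Ne.symm hb]
      · simp [Pi.single_apply, ite_smul]
  obtain ⟨U, -, hU⟩ := exists_minimal_le_of_wellFoundedLT Gen _ hG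
  obtain ⟨⟨haU, hgen⟩, hmin⟩ := hU
  choose m hm0 hmU hm using hgen
  have hedge : ∀ w ∈ U, EdgePair p a w := by
    intro w hw
    have haw : a ≠ w := fun h => haU (h ▸ hw)
    refine ⟨haw, fun c s t hc hs ht hst hcp u hua huw => ?_⟩
    by_contra hcu
    have hcu' : 0 < c u := lt_of_le_of_ne (hc u) (Ne.symm hcu)
    set γ : W → ℝ := fun x => ∑ v, c v * m v x with hγ
    have hγ0 : ∀ x, 0 ≤ γ x := fun x => Finset.sum_nonneg fun v _ => mul_nonneg (hc v) (hm0 v x)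
    have hsum : ∑ x, γ x • (p x - p a) = t • (p w - p a) := by
      have h1 : ∑ v, c v • (p v - p a) = t • (p w - p a) := by
        rw [sum_smul_sub, hcp, hst]; module
      rw [← h1]
      simp only [hγ, Finset.sum_smul]
      rw [Finset.sum_comm]
      refine Finset.sum_congr rfl fun v _ => ?_
      rw [hm v, Finset.smul_sum]
      exact Finset.sum_congr rfl fun x _ => by rw [mul_smul]
    have hγU : ∀ x, x ∉ U → γ x = 0 := fun x hx =>
      Finset.sum_eq_zero fun v _ => by rw [hmU v x hx, mul_zero]
    rcases lt_or_ge (γ w) t with hlt | hge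
    · have hsub : Gen (U.erase w) := by
        refine ⟨fun h => haU (Finset.mem_of_mem_erase h), fun b => ?_⟩
        have hpos : 0 < t - γ w := by linarith
        refine ⟨fun x => if x = w then 0 else m b x + m b w * (γ x / (t - γ w)), fun x => ?_,
          fun x hx => ?_, ?_⟩
        · dsimp only
          split_ifs
          · exact le_rfl
          · have := hm0 b x
            have := hm0 b w
            have := hγ0 x
            positivity
        · dsimp only
          split_ifs with hxw
          · rfl
          · have hxU : x ∉ U := fun h => hx (Finset.mem_erase.2 ⟨hxw, h⟩)
            rw [hmU b x hxU, hγU x hxU]; simp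
        · have hw' : p w - p a = ∑ x, (if x = w then 0 else γ x / (t - γ w)) • (p x - p a) := by
            have h2 : ∑ x, (if x = w then 0 else γ x) • (p x - p a)
                = (t - γ w) • (p w - p a) := by
              rw [sum_ite_smul, hsum]; module
            have h3 : p w - p a = (t - γ w)⁻¹ • ((t - γ w) • (p w - p a)) := by
              rw [smul_smul, inv_mul_cancel₀ hpos.ne', one_smul]
            rw [h3, ← h2, Finset.smul_sum]
            refine Finset.sum_congr rfl fun x _ => ?_
            rw [smul_smul]
            congr 1
            split_ifs <;> ring
          have h4 : p b - p a = m b w • (p w - p a)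
              + ∑ x, (if x = w then 0 else m b x) • (p x - p a) := by
            rw [sum_ite_smul, ← hm b]; module
          rw [h4, hw', Finset.smul_sum, ← Finset.sum_add_distrib]
          refine Finset.sum_congr rfl fun x _ => ?_
          rw [smul_smul, ← add_smul]
          congr 1
          dsimp only
          split_ifs <;> ring
      have := hmin hsub (Finset.erase_subset _ _) hw
      simp at this
    · have h5 := hp.eq_zero_of_sum_sub (a := a) (c := fun x => if x = w then γ w - t else γ x)
        (fun x => by
          split_ifs
          · linarith
          · exact hγ0 x) (by
          rw [sum_ite_smul, hsum]; module)
      have h6 : ∀ x, x ≠ w → m u x = 0 := by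
        intro x hxw
        by_cases hxa : x = a
        · exact hmU u x (hxa ▸ haU)
        · have h7 := h5 x hxa
          rw [if_neg hxw] at h7
          have h8 := (Finset.sum_eq_zero_iff_of_nonneg
            fun v _ => mul_nonneg (hc v) (hm0 v x)).1 h7 u (Finset.mem_univ u)
          exact (mul_eq_zero.1 h8).resolve_left hcu
      refine hp.not_collinear haw (Ne.symm hua) (Ne.symm huw) (m u w) ?_
      rw [hm u]
      exact Finset.sum_eq_single w (fun x _ hx => by rw [h6 x hx, zero_smul]) (by simp)
  exact ⟨m b, hm0 b, fun u hu => hedge u (by_contra fun h => hu (hmU b u h)), hm b⟩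

theorem affine_sum_eq {p : W → E} {q : W → F} {v : E} {φ : F →ₗ[ℝ] E}
    (h : ∀ u, p u = v + φ (q u)) (c : W → ℝ) :
    ∑ u, c u • p u = (∑ u, c u) • v + φ (∑ u, c u • q u) := by
  simp only [h, smul_add, Finset.sum_add_distrib, Finset.sum_smul, map_sum, map_smul]

theorem ConvexlyIndependent.of_affine {p : W → E} {q : W → F} {v : E} {φ : F →ₗ[ℝ] E}
    (h : ∀ u, p u = v + φ (q u)) (hp : ConvexlyIndependent p) : ConvexlyIndependent q := by
  intro a c hc hq
  refine hp a c hc ?_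
  rw [affine_sum_eq h, hq, h a, map_smul, smul_add]

theorem edgePair_affine_iff {p : W → E} {q : W → F} {v : E} {φ : F →ₗ[ℝ] E}
    (hφ : Function.Injective φ) (h : ∀ u, p u = v + φ (q u)) (a b : W) :
    EdgePair p a b ↔ EdgePair q a b := by
  have : ∀ (c : W → ℝ) (s t : ℝ), ∑ u, c u = s + t →
      (∑ u, c u • p u = s • p a + t • p b ↔ ∑ u, c u • q u = s • q a + t • q b) := by
    intro c s t hst
    rw [affine_sum_eq h, hst, h a, h b]
    have : s • (v + φ (q a)) + t • (v + φ (q b)) = (s + t) • v + φ (s • q a + t • q b) := by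
      rw [map_add, map_smul, map_smul]; module
    rw [this, add_right_inj, hφ.eq_iff]
  constructor
  · rintro ⟨h1, h2⟩
    exact ⟨h1, fun c s t hc hs ht hst hq => h2 c s t hc hs ht hst ((this c s t hst).2 hq)⟩
  · rintro ⟨h1, h2⟩
    exact ⟨h1, fun c s t hc hs ht hst hq => h2 c s t hc hs ht hst ((this c s t hst).1 hq)⟩

theorem ConvexlyIndependent.comp_equiv {W' : Type*} [Fintype W'] {p : W → E}
    (hp : ConvexlyIndependent p) (σ : W' ≃ W) : ConvexlyIndependent (p ∘ σ) := by
  intro a c hc h u hu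
  have := hp (σ a) (c ∘ σ.symm) (fun u => hc _) (by
    rw [← σ.sum_comp, ← σ.sum_comp (fun u => (c ∘ σ.symm) u)]
    simpa using h) (σ u) (by simpa using hu)
  simpa using this

theorem edgePair_comp_equiv {W' : Type*} [Fintype W'] (p : W → E) (σ : W' ≃ W) (a b : W') :
    EdgePair (p ∘ σ) a b ↔ EdgePair p (σ a) (σ b) := by
  constructor
  · rintro ⟨h1, h2⟩
    refine ⟨by simpa using h1, fun c s t hc hs ht hst hq u hua hub => ?_⟩
    have := h2 (c ∘ σ) s t (fun u => hc _) hs ht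
      (by rw [← hst, ← σ.sum_comp]; rfl)
      (by rw [← σ.sum_comp] at hq; exact hq) (σ.symm u)
      (fun h => hua (by simp [← h])) (fun h => hub (by simp [← h]))
    simpa using this
  · rintro ⟨h1, h2⟩
    refine ⟨fun h => h1 (congrArg σ h), fun c s t hc hs ht hst hq u hua hub => ?_⟩
    have := h2 (c ∘ σ.symm) s t (fun u => hc _) hs ht
      (by rw [← hst, ← σ.sum_comp]; simp)
      (by rw [← σ.sum_comp]; simpa using hq) (σ u)
      (by simpa using hua) (by simpa using hub)
    simpa using this

end Families

section Hull

variable {W E : Type*} [Fintype W] [AddCommGroup E] [Module ℝ E]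

theorem mem_convexHull_range_iff {p : W → E} {x : E} : x ∈ convexHull ℝ (Set.range p) ↔
    ∃ c : W → ℝ, (∀ u, 0 ≤ c u) ∧ ∑ u, c u = 1 ∧ ∑ u, c u • p u = x := by
  classical
  constructor
  · intro hx
    let K : Set E := {x | ∃ c : W → ℝ, (∀ u, 0 ≤ c u) ∧ ∑ u, c u = 1 ∧ ∑ u, c u • p u = x}
    have hK : Convex ℝ K := by
      rintro x ⟨c, hc, hc1, rfl⟩ y ⟨e, he, he1, rfl⟩ s t hs ht hst
      refine ⟨fun u => s * c u + t * e u, fun u => ?_, ?_, ?_⟩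
      · exact add_nonneg (mul_nonneg hs (hc u)) (mul_nonneg ht (he u))
      · rw [Finset.sum_add_distrib, ← Finset.mul_sum, ← Finset.mul_sum, hc1, he1]
        linarith
      · simp only [add_smul, mul_smul, Finset.sum_add_distrib, Finset.smul_sum]
    refine convexHull_min (t := K) ?_ hK hx
    rintro _ ⟨u, rfl⟩
    refine ⟨Pi.single u 1, fun v => ?_, by simp, by simp [Pi.single_apply, ite_smul]⟩
    by_cases h : v = u
    · subst h; simp
    · simp [h]
  · rintro ⟨c, hc, hc1, rfl⟩
    exact (convex_convexHull ℝ _).sum_mem (fun u _ => hc u) hc1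
      fun u _ => subset_convexHull ℝ _ (Set.mem_range_self u)

theorem IsExtreme.mem_of_sum_mem_s2 {P A : Set E} (hP : Convex ℝ P) (hA : IsExtreme ℝ P A)
    {p : W → E} (hp : ∀ u, p u ∈ P) {c : W → ℝ} (hc : ∀ u, 0 ≤ c u) (hc1 : ∑ u, c u = 1)
    (hx : ∑ u, c u • p u ∈ A) {u : W} (hu : c u ≠ 0) : p u ∈ A := by
  classical
  have hpos : 0 < c u := lt_of_le_of_ne (hc u) hu.symm
  have hs : c u + ∑ v ∈ Finset.univ.erase u, c v = 1 := by
    rw [Finset.add_sum_erase _ _ (Finset.mem_univ u), hc1]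
  have hsp : c u • p u + ∑ v ∈ Finset.univ.erase u, c v • p v = ∑ v, c v • p v :=
    Finset.add_sum_erase _ (fun v => c v • p v) (Finset.mem_univ u)
  rcases (Finset.sum_nonneg fun v (_ : v ∈ Finset.univ.erase u) => hc v).eq_or_lt with h0 | hr
  · have hz := (Finset.sum_eq_zero_iff_of_nonneg
      (fun v (_ : v ∈ Finset.univ.erase u) => hc v)).1 h0.symm
    rw [Finset.sum_eq_zero (fun v hv => by rw [hz v hv, zero_smul])] at hsp
    rw [← h0, add_zero] at hs
    rw [hs, one_smul, add_zero] at hsp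
    rw [hsp]
    exact hx
  · set r := ∑ v ∈ Finset.univ.erase u, c v with hrdef
    have hz : ∑ v ∈ Finset.univ.erase u, (c v / r) • p v ∈ P :=
      hP.sum_mem (fun v _ => div_nonneg (hc v) hr.le)
        (by rw [← Finset.sum_div, ← hrdef, div_self hr.ne']) fun v _ => hp v
    refine hA.left_mem_of_mem_openSegment (hp u) hz hx ⟨c u, r, hpos, hr, hs, ?_⟩
    rw [← hsp, Finset.smul_sum]
    congr 1
    refine Finset.sum_congr rfl fun v _ => ?_
    rw [smul_smul, mul_div_cancel₀ _ hr.ne']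

theorem convexlyIndependent_of_extremePoints {p : W → E} (hinj : Function.Injective p)
    (hp : ∀ u, p u ∈ Set.extremePoints ℝ (convexHull ℝ (Set.range p))) :
    ConvexlyIndependent p := by
  intro a c hc h u hua
  by_contra hcu
  have hΓ : 0 < ∑ u, c u :=
    lt_of_lt_of_le (lt_of_le_of_ne (hc u) (Ne.symm hcu))
      (Finset.single_le_sum (fun v _ => hc v) (Finset.mem_univ u))
  have := (isExtreme_singleton.2 (hp a)).mem_of_sum_mem_s2 (convex_convexHull ℝ _)
    (fun u => (hp u).1) (c := fun u => c u / ∑ u, c u) (fun u => div_nonneg (hc u) hΓ.le)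
    (by rw [← Finset.sum_div, div_self hΓ.ne']) (u := u) (by
      have : ∑ v, (c v / ∑ u, c u) • p v = (∑ u, c u)⁻¹ • ∑ v, c v • p v := by
        rw [Finset.smul_sum]
        exact Finset.sum_congr rfl fun v _ => by rw [smul_smul, div_eq_inv_mul]
      rw [this, h, smul_smul, inv_mul_cancel₀ hΓ.ne', one_smul]
      rfl) (div_ne_zero hcu hΓ.ne')
  exact hua (hinj this)

theorem EdgePair.isExtreme_segment {p : W → E} {a b : W} (h : EdgePair p a b) :
    IsExtreme ℝ (convexHull ℝ (Set.range p)) (segment ℝ (p a) (p b)) := by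
  classical
  refine ⟨?_, ?_⟩
  · exact (convex_convexHull ℝ _).segment_subset (subset_convexHull ℝ _ (Set.mem_range_self a))
      (subset_convexHull ℝ _ (Set.mem_range_self b))
  · intro x hx y hy z hz hxyz
    obtain ⟨c, hc, hc1, rfl⟩ := mem_convexHull_range_iff.1 hx
    obtain ⟨e, he, he1, rfl⟩ := mem_convexHull_range_iff.1 hy
    obtain ⟨s, t, hs, ht, hst, hzs⟩ := hz
    obtain ⟨α, β, hα, hβ, hαβ, hzα⟩ := hxyz
    have h0 := h.2 (fun u => α * c u + β * e u) s t
      (fun u => add_nonneg (mul_nonneg hα.le (hc u)) (mul_nonneg hβ.le (he u))) hs ht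
      (by rw [Finset.sum_add_distrib, ← Finset.mul_sum, ← Finset.mul_sum, hc1, he1]; linarith)
      (by rw [hzs, ← hzα]
          simp only [add_smul, mul_smul, Finset.sum_add_distrib, Finset.smul_sum])
    have hc0 : ∀ u, u ≠ a → u ≠ b → c u = 0 := by
      intro u hua hub
      have h1 := h0 u hua hub
      have h2 := mul_nonneg hα.le (hc u)
      have h3 := mul_nonneg hβ.le (he u)
      exact (mul_eq_zero.1 (by linarith : α * c u = 0)).resolve_left hα.ne'
    have hsupp : ∀ u ∈ Finset.univ, u ∉ ({a, b} : Finset W) → c u = 0 := by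
      intro u _ hu
      simp only [Finset.mem_insert, Finset.mem_singleton, not_or] at hu
      exact hc0 u hu.1 hu.2
    refine ⟨c a, c b, hc a, hc b, ?_, ?_⟩
    · rw [← hc1, ← Finset.sum_pair (f := c) h.1]
      exact Finset.sum_subset (Finset.subset_univ _) hsupp
    · rw [← Finset.sum_pair (f := fun u => c u • p u) h.1]
      exact Finset.sum_subset (Finset.subset_univ _) fun u hu hu' => by
        rw [hsupp u hu hu', zero_smul]

theorem edgePair_of_isExtreme {p : W → E} {a b : W} (hab : a ≠ b) {A : Set E}
    (hA : IsExtreme ℝ (convexHull ℝ (Set.range p)) A) (hAc : Convex ℝ A)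
    (h : ∀ u, p u ∈ A ↔ u = a ∨ u = b) : EdgePair p a b := by
  refine ⟨hab, fun c s t hc hs ht hst hx u hua hub => ?_⟩
  by_contra hcu
  have hΓ : 0 < s + t := by
    rw [← hst]
    exact lt_of_lt_of_le (lt_of_le_of_ne (hc u) (Ne.symm hcu))
      (Finset.single_le_sum (fun v _ => hc v) (Finset.mem_univ u))
  have := hA.mem_of_sum_mem_s2 (convex_convexHull ℝ _)
    (fun u => subset_convexHull ℝ _ (Set.mem_range_self u))
    (c := fun u => c u / (s + t)) (fun u => div_nonneg (hc u) hΓ.le)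
    (by rw [← Finset.sum_div, hst, div_self hΓ.ne']) (u := u) (by
      have : ∑ v, (c v / (s + t)) • p v = (s / (s + t)) • p a + (t / (s + t)) • p b := by
        have : ∑ v, (c v / (s + t)) • p v = (s + t)⁻¹ • ∑ v, c v • p v := by
          rw [Finset.smul_sum]
          exact Finset.sum_congr rfl fun v _ => by rw [smul_smul, div_eq_inv_mul]
        rw [this, hx, smul_add, smul_smul, smul_smul, div_eq_inv_mul, div_eq_inv_mul]
      rw [this]
      exact hAc ((h a).2 (Or.inl rfl)) ((h b).2 (Or.inr rfl)) (div_nonneg hs hΓ.le)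
        (div_nonneg ht hΓ.le) (by rw [← add_div, div_self hΓ.ne'])) (div_ne_zero hcu hΓ.ne')
  exact ((h u).1 this).elim hua hub

theorem IsExtreme.eq_convexHull {p : W → E} {A : Set E}
    (hA : IsExtreme ℝ (convexHull ℝ (Set.range p)) A) (hAc : Convex ℝ A) :
    A = convexHull ℝ (p '' {u | p u ∈ A}) := by
  classical
  refine Set.Subset.antisymm (fun x hx => ?_) (convexHull_min ?_ hAc)
  · obtain ⟨c, hc, hc1, rfl⟩ := mem_convexHull_range_iff.1 (hA.subset hx)
    have hmem := fun u => hA.mem_of_sum_mem_s2 (convex_convexHull ℝ _)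
      (fun u => subset_convexHull ℝ _ (Set.mem_range_self u)) hc hc1 hx (u := u)
    have hz : ∀ u ∈ Finset.univ, u ∉ Finset.univ.filter (fun u => p u ∈ A) → c u = 0 := by
      intro u _ hu
      by_contra h
      exact hu (by simpa using hmem u h)
    rw [← Finset.sum_subset (Finset.subset_univ (Finset.univ.filter fun u => p u ∈ A))
      fun u hu hu' => by rw [hz u hu hu', zero_smul]]
    refine (convex_convexHull ℝ _).sum_mem (fun u _ => hc u) ?_ fun u hu => ?_
    · rw [← hc1]
      exact Finset.sum_subset (Finset.subset_univ _) hz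
    · exact subset_convexHull ℝ _ ⟨u, by simpa using hu, rfl⟩
  · rintro _ ⟨u, hu, rfl⟩
    exact hu

/-- The graph of the convex hull of a finite family of points. -/
def edgeGraph (p : W → E) : SimpleGraph W where
  Adj := EdgePair p
  symm := ⟨fun _ _ h => h.symm⟩
  loopless := ⟨fun _ h => h.1 rfl⟩

end Hull

section Polytopes

theorem isEdge_iff {n : ℕ} {W : Type*} [Fintype W] {p : W → Fin n → ℝ}
    (hp : ConvexlyIndependent p) (A : Set (Fin n → ℝ)) :
    IsEdge (convexHull ℝ (Set.range p)) A ↔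
      ∃ a b, EdgePair p a b ∧ A = segment ℝ (p a) (p b) := by
  classical
  constructor
  · rintro ⟨hA, hAc, hdim⟩
    have hAeq := hA.eq_convexHull hAc
    set U : Set W := {u | p u ∈ A} with hU
    have hnt : U.Nontrivial := by
      rw [← Set.not_subsingleton_iff]
      intro hs
      have : A.Subsingleton := by
        rcases hs.eq_empty_or_singleton with h | ⟨u, h⟩
        · rw [hAeq, h]; simp
        · rw [hAeq, h]; simp
      have h0 : vectorSpan ℝ A = ⊥ := vectorSpan_of_subsingleton ℝ this
      rw [adim, h0, finrank_bot] at hdim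
      exact zero_ne_one hdim
    obtain ⟨a, ha, b, hb, hab⟩ := hnt
    have hv : ∀ u ∈ U, p u - p a ∈ vectorSpan ℝ A := fun u hu =>
      vsub_mem_vectorSpan ℝ hu ha
    have hne : p b - p a ≠ 0 := by
      intro h
      have := hp a (Pi.single b 1) (fun u => by
        by_cases h : u = b
        · subst h; simp
        · simp [h]) (by simpa [Pi.single_apply, ite_smul] using sub_eq_zero.1 h) b hab.symm
      simp at this
    have hUab : ∀ u, p u ∈ A ↔ u = a ∨ u = b := by
      intro u
      refine ⟨fun hu => ?_, ?_⟩
      · by_contra hcon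
        push Not at hcon
        obtain ⟨r, hr⟩ := (finrank_eq_one_iff_of_nonzero'
          (⟨p b - p a, hv b hb⟩ : vectorSpan ℝ A) (by simpa using hne)).1 hdim
          ⟨p u - p a, hv u hu⟩
        exact hp.not_collinear hab hcon.1.symm hcon.2.symm r
          (by simpa using (congrArg Subtype.val hr).symm)
      · rintro (rfl | rfl)
        · exact ha
        · exact hb
    refine ⟨a, b, edgePair_of_isExtreme hab hA hAc hUab, ?_⟩
    have : U = {a, b} := Set.ext hUab
    rw [hAeq, this, Set.image_pair, convexHull_pair]
  · rintro ⟨a, b, h, rfl⟩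
    refine ⟨h.isExtreme_segment, convex_segment _ _, ?_⟩
    have hne : p b - p a ≠ 0 := by
      intro h0
      have := hp a (Pi.single b 1) (fun u => by
        by_cases h : u = b
        · subst h; simp
        · simp [h]) (by simpa [Pi.single_apply, ite_smul] using sub_eq_zero.1 h0) b h.1.symm
      simp at this
    rw [adim, vectorSpan_segment]
    exact finrank_span_singleton hne

theorem f₁_convexHull_range {n : ℕ} {W : Type*} [Fintype W] {p : W → Fin n → ℝ}
    (hp : ConvexlyIndependent p) :
    f₁ (convexHull ℝ (Set.range p)) = (edgeGraph p).edgeSet.ncard := by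
  classical
  let φ : Sym2 W → Set (Fin n → ℝ) := fun e => convexHull ℝ (p '' {u | u ∈ e})
  have hφ : ∀ a b, φ s(a, b) = segment ℝ (p a) (p b) := by
    intro a b
    have : {u | u ∈ s(a, b)} = ({a, b} : Set W) := by ext; simp
    simp only [φ, this, Set.image_pair, convexHull_pair]
  have himg : {A | IsEdge (convexHull ℝ (Set.range p)) A} = φ '' (edgeGraph p).edgeSet := by
    ext A
    simp only [Set.mem_ofPred_eq, isEdge_iff hp, Set.mem_image]
    constructor
    · rintro ⟨a, b, h, rfl⟩
      exact ⟨s(a, b), h, hφ a b⟩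
    · rintro ⟨e, he, rfl⟩
      induction e with
      | h a b => exact ⟨a, b, he, hφ a b⟩
  have hmem : ∀ a b u, EdgePair p a b → p u ∈ segment ℝ (p a) (p b) → u = a ∨ u = b := by
    intro a b u h hu
    obtain ⟨s, t, hs, ht, hst, hx⟩ := hu
    by_contra hcon
    push Not at hcon
    have := h.2 (Pi.single u 1) s t (fun v => by
        by_cases h : v = u
        · subst h; simp
        · simp [h]) hs ht (by simpa using hst.symm)
      (by simpa [Pi.single_apply, ite_smul] using hx.symm) u hcon.1 hcon.2
    simp at this
  rw [f₁, himg]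
  refine Set.InjOn.ncard_image fun e he e' he' heq => ?_
  induction e with
  | h a b =>
    induction e' with
    | h a' b' =>
      rw [hφ, hφ] at heq
      have h1 := hmem a' b' a he' (heq ▸ left_mem_segment ℝ _ _)
      have h2 := hmem a' b' b he' (heq ▸ right_mem_segment ℝ _ _)
      have h3 : a ≠ b := he.1
      rcases h1 with rfl | rfl <;> rcases h2 with rfl | rfl <;> simp_all [Sym2.eq_swap]

/-- Every polytope is the convex hull of the convexly independent family of its vertices. -/
theorem IsDPolytope.exists_family {d n : ℕ} {P : Set (Fin n → ℝ)} (h : IsDPolytope d P) :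
    ∃ p : Fin (f₀ P) → Fin n → ℝ, ConvexlyIndependent p ∧
      f₁ P = (edgeGraph p).edgeSet.ncard ∧
      Module.finrank ℝ (vectorSpan ℝ (Set.range p)) = d := by
  obtain ⟨⟨S, rfl⟩, hd⟩ := h
  set P := convexHull ℝ (S : Set (Fin n → ℝ)) with hP
  have hfin : (Set.extremePoints ℝ P).Finite :=
    S.finite_toSet.subset extremePoints_convexHull_subset
  have hhull : convexHull ℝ (Set.extremePoints ℝ P) = P := by
    have hKM := closure_convexHull_extremePoints (S.finite_toSet.isCompact_convexHull ℝ)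
      (convex_convexHull ℝ (S : Set (Fin n → ℝ)))
    rwa [(hfin.isClosed_convexHull ℝ).closure_eq] at hKM
  have : Finite (Set.extremePoints ℝ P) := hfin
  let e : Fin (f₀ P) ≃ Set.extremePoints ℝ P :=
    (Finite.equivFinOfCardEq (α := Set.extremePoints ℝ P) rfl).symm
  have hrange : Set.range (fun i => (e i : Fin n → ℝ)) = Set.extremePoints ℝ P := by
    ext x
    constructor
    · rintro ⟨i, rfl⟩
      exact (e i).2
    · intro hx
      exact ⟨e.symm ⟨x, hx⟩, by simp⟩
  have hhull' : convexHull ℝ (Set.range fun i => (e i : Fin n → ℝ)) = P := by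
    rw [hrange, hhull]
  have hind : ConvexlyIndependent (fun i => (e i : Fin n → ℝ)) :=
    convexlyIndependent_of_extremePoints (Subtype.val_injective.comp e.injective)
      fun u => by rw [hhull']; exact (e u).2
  refine ⟨fun i => e i, hind, ?_, ?_⟩
  · rw [← f₁_convexHull_range hind, hhull']
  · have hspan := affineSpan_convexHull (𝕜 := ℝ) (Set.range fun i => (e i : Fin n → ℝ))
    rw [hhull'] at hspan
    rw [← hd, adim, ← direction_affineSpan, ← direction_affineSpan, hspan]

end Polytopes
section Coordinates

variable {W E : Type*} [Fintype W] [AddCommGroup E] [Module ℝ E]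

open Classical in
theorem ConvexlyIndependent.span_edges {p : W → E} (hp : ConvexlyIndependent p) (a : W) :
    Submodule.span ℝ (Set.range fun u : {u // EdgePair p a u} => p u - p a)
      = vectorSpan ℝ (Set.range p) := by
  rw [vectorSpan_range_eq_span_range_vsub_right ℝ p a]
  refine le_antisymm (Submodule.span_mono ?_) (Submodule.span_le.2 ?_)
  · rintro _ ⟨u, rfl⟩
    exact ⟨u, rfl⟩
  · rintro _ ⟨b, rfl⟩
    obtain ⟨c, -, hc, h⟩ := hp.exists_edge_coeff a b
    simp only [vsub_eq_sub, h]
    refine Submodule.sum_mem _ fun u _ => ?_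
    by_cases hu : c u = 0
    · simp [hu]
    · exact Submodule.smul_mem _ _ (Submodule.subset_span ⟨⟨u, hc u hu⟩, rfl⟩)

open Classical in
/-- Every vertex of a `d`-polytope lies on at least `d` edges. -/
theorem ConvexlyIndependent.finrank_le_degree {p : W → E} (hp : ConvexlyIndependent p) (a : W) :
    Module.finrank ℝ (vectorSpan ℝ (Set.range p)) ≤ (edgeGraph p).degree a := by
  rw [← hp.span_edges a, ← SimpleGraph.card_neighborSet_eq_degree]
  exact finrank_range_le_card _

/-- The points of a family in convex position form a vertex at the origin, the standard basis
vectors, which are its neighbours, and further points, which are not. -/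
structure SimpleAtOrigin {I J : Type*} [Fintype I] [DecidableEq I] [Fintype J]
    (q : Option (I ⊕ J) → I → ℝ) : Prop where
  indep : ConvexlyIndependent q
  origin : q none = 0
  axis : ∀ i, q (some (Sum.inl i)) = Pi.single i 1
  nonneg : ∀ u i, 0 ≤ q u i
  edge_axis : ∀ i, EdgePair q none (some (Sum.inl i))
  not_edge : ∀ j, ¬ EdgePair q none (some (Sum.inr j))

open Classical in
/-- A polytope with a vertex of minimal degree can be put in the position `SimpleAtOrigin`
without changing its graph. -/
theorem ConvexlyIndependent.exists_simpleAtOrigin {p : W → E} (hp : ConvexlyIndependent p)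
    (a : W) {d : ℕ} (hd : Module.finrank ℝ (vectorSpan ℝ (Set.range p)) = d)
    (ha : (edgeGraph p).degree a = d) :
    ∃ (q : Option ({u // EdgePair p a u} ⊕ {u // u ≠ a ∧ ¬ EdgePair p a u}) →
        {u // EdgePair p a u} → ℝ)
      (σ : Option ({u // EdgePair p a u} ⊕ {u // u ≠ a ∧ ¬ EdgePair p a u}) ≃ W),
      SimpleAtOrigin q ∧ ∀ b b', EdgePair q b b' ↔ EdgePair p (σ b) (σ b') := by
  let I := {u // EdgePair p a u}
  let J := {u // u ≠ a ∧ ¬ EdgePair p a u}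
  let f : Option (I ⊕ J) → W := fun b => b.elim a (Sum.elim Subtype.val Subtype.val)
  have hf : Function.Bijective f := by
    constructor
    · rintro (_ | ⟨i⟩ | ⟨j⟩) (_ | ⟨i'⟩ | ⟨j'⟩) h
      · rfl
      · exact absurd h i'.2.1
      · exact absurd h.symm j'.2.1
      · exact absurd h.symm i.2.1
      · rw [Subtype.ext (h : i.1 = i'.1)]
      · have h' : i.1 = j'.1 := h
        exact absurd (h' ▸ i.2) j'.2.2
      · exact absurd h j.2.1
      · have h' : j.1 = i'.1 := h
        exact absurd (h' ▸ i'.2) j.2.2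
      · rw [Subtype.ext (h : j.1 = j'.1)]
    · intro u
      by_cases hua : u = a
      · exact ⟨none, hua.symm⟩
      · by_cases hu : EdgePair p a u
        · exact ⟨some (Sum.inl ⟨u, hu⟩), rfl⟩
        · exact ⟨some (Sum.inr ⟨u, hua, hu⟩), rfl⟩
  let σ : Option (I ⊕ J) ≃ W := Equiv.ofBijective f hf
  let g : I → E := fun u => p u - p a
  have hg : LinearIndependent ℝ g := by
    rw [linearIndependent_iff_card_eq_finrank_span, Set.finrank, hp.span_edges a, hd, ← ha,
      ← SimpleGraph.card_neighborSet_eq_degree]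
    rfl
  let φ : (I → ℝ) →ₗ[ℝ] E := Fintype.linearCombination ℝ g
  have hφ : Function.Injective φ := linearIndependent_iff_injective_fintypeLinearCombination.1 hg
  choose c hc0 hc hcp using fun b => hp.exists_edge_coeff a b
  let q : Option (I ⊕ J) → I → ℝ := fun b i => c (σ b) i
  have hq : ∀ b, (p ∘ σ) b = p a + φ (q b) := by
    intro b
    rw [← sub_eq_iff_eq_add']
    change p (σ b) - p a = ∑ i : I, c (σ b) i • (p i - p a)
    rw [hcp (σ b)]
    symm
    rw [← Finset.sum_subtype (Finset.univ.filter fun u => EdgePair p a u) (by simp)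
      fun u => c (σ b) u • (p u - p a)]
    refine Finset.sum_subset (Finset.subset_univ _) fun u _ hu => ?_
    have h0 : c (σ b) u = 0 := by_contra fun h => hu (by simpa using hc _ u h)
    rw [h0, zero_smul]
  have hedge : ∀ b b', EdgePair q b b' ↔ EdgePair p (σ b) (σ b') := fun b b' =>
    (edgePair_affine_iff hφ hq b b').symm.trans (edgePair_comp_equiv p σ b b')
  refine ⟨q, σ, ⟨(hp.comp_equiv σ).of_affine hq, ?_, fun i => ?_, fun u i => hc0 _ _,
    fun i => (hedge _ _).2 i.2, fun j h => j.2.2 ((hedge _ _).1 h)⟩, hedge⟩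
  · apply hφ
    have h := hq none
    change p a = _ at h
    rw [map_zero]
    exact (left_eq_add.1 h)
  · apply hφ
    have h := hq (some (Sum.inl i))
    change p i = _ at h
    rw [← sub_eq_iff_eq_add'] at h
    rw [← h]
    change p i - p a = ∑ i' : I, (Pi.single i 1 : I → ℝ) i' • (p i' - p a)
    rw [Fintype.sum_eq_single i fun i' hi' => by rw [Pi.single_eq_of_ne hi', zero_smul],
      Pi.single_eq_same, one_smul]

end Coordinates

theorem not_edgePair_self {W E : Type*} [Fintype W] [AddCommGroup E] [Module ℝ E] {p : W → E}
    (a : W) : ¬ EdgePair p a a := fun h => h.1 rfl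

section SimpleVertex

/-- The coordinates in which a point that is not adjacent to the origin is positive. -/
noncomputable def support {I J : Type*} [Fintype I] (q : Option (I ⊕ J) → I → ℝ) (j : J) : Finset I :=
  Finset.univ.filter fun i => q (some (Sum.inr j)) i ≠ 0

theorem mem_support {I J : Type*} [Fintype I] {q : Option (I ⊕ J) → I → ℝ} {j : J} {i : I} :
    i ∈ support q j ↔ q (some (Sum.inr j)) i ≠ 0 := by
  simp [support]

theorem support_subset_iff {I J : Type*} [Fintype I] {q : Option (I ⊕ J) → I → ℝ} {j : J}
    {T : Finset I} :
    support q j ⊆ T ↔ ∀ i ∉ T, q (some (Sum.inr j)) i = 0 := by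
  simp only [Finset.subset_iff, mem_support]
  exact forall_congr' fun i => not_imp_comm

theorem card_filter_option_sum {I J : Type*} [Fintype I] [Fintype J] (P : Option (I ⊕ J) → Prop)
    [DecidablePred P] :
    (Finset.univ.filter P).card = (if P none then 1 else 0)
      + (Finset.univ.filter fun i => P (some (Sum.inl i))).card
      + (Finset.univ.filter fun j => P (some (Sum.inr j))).card := by
  simp only [Finset.card_filter, Fintype.sum_option, Fintype.sum_sum_type, add_assoc]

open Classical in
/-- The neighbours of the origin that are not adjacent to the vertex `j`. -/
noncomputable def nonadjAxes {I J : Type*} [Fintype I] [Fintype J]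
    (q : Option (I ⊕ J) → I → ℝ) (j : J) : Finset I :=
  Finset.univ.filter fun i => ¬ EdgePair q (some (Sum.inr j)) (some (Sum.inl i))

theorem mem_nonadjAxes {I J : Type*} [Fintype I] [Fintype J] {q : Option (I ⊕ J) → I → ℝ}
    {j : J} {i : I} : i ∈ nonadjAxes q j ↔
      ¬ EdgePair q (some (Sum.inr j)) (some (Sum.inl i)) := by
  simp [nonadjAxes]

theorem eq_zero_of_support_eq_pair {I J : Type*} [Fintype I] [DecidableEq I]
    {q : Option (I ⊕ J) → I → ℝ} {j : J} {i i' u : I} (hj : support q j = {i, i'})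
    (hi : u ≠ i) (hi' : u ≠ i') : q (some (Sum.inr j)) u = 0 := by
  by_contra hne
  have := mem_support.2 hne
  rw [hj] at this
  simp_all

namespace SimpleAtOrigin

variable {I J : Type*} [Fintype I] [DecidableEq I] [Fintype J] {q : Option (I ⊕ J) → I → ℝ}

theorem axis_face (h : SimpleAtOrigin q) {i : I} {T : Finset I} :
    (∀ i' ∉ T, q (some (Sum.inl i)) i' = 0) ↔ i ∈ T := by
  rw [h.axis]
  constructor
  · intro hi
    by_contra hiT
    simpa using hi i hiT
  · intro hi i' hi'
    exact Pi.single_eq_of_ne (fun e => hi' (by rwa [e])) _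

theorem pos_of_mem_support (h : SimpleAtOrigin q) {j : J} {i : I} (hi : i ∈ support q j) :
    0 < q (some (Sum.inr j)) i :=
  lt_of_le_of_ne (h.nonneg _ _) (Ne.symm (mem_support.1 hi))

theorem exists_edge_coeff (h : SimpleAtOrigin q) (T : Finset I) {v b : Option (I ⊕ J)}
    (hv : ∀ i ∉ T, q v i = 0) (hb : ∀ i ∉ T, q b i = 0) :
    ∃ c : Option (I ⊕ J) → ℝ, (∀ u, 0 ≤ c u) ∧
      (∀ u, c u ≠ 0 → EdgePair q v u ∧ ∀ i ∉ T, q u i = 0) ∧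
      q b - q v = ∑ u, c u • (q u - q v) := by
  classical
  obtain ⟨c, hc0, hc, hs⟩ := h.indep.exists_edge_coeff v b
  refine ⟨c, hc0, fun u hu => ⟨hc u hu, fun i hi => ?_⟩, hs⟩
  have hsi := congrFun hs i
  simp only [Pi.sub_apply, hv i hi, hb i hi, Finset.sum_apply, Pi.smul_apply, smul_eq_mul,
    sub_zero] at hsi
  have h0 := (Finset.sum_eq_zero_iff_of_nonneg fun u _ => mul_nonneg (hc0 u) (h.nonneg u i)).1
    hsi.symm u (Finset.mem_univ u)
  exact (mul_eq_zero.1 h0).resolve_left hu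

open Classical in
/-- Every vertex of the coordinate face spanned by `T` lies on at least `T.card` edges of it. -/
theorem card_le_face_degree (h : SimpleAtOrigin q) (T : Finset I) {v : Option (I ⊕ J)}
    (hv : ∀ i ∉ T, q v i = 0) :
    T.card ≤ (Finset.univ.filter fun u => EdgePair q v u ∧ ∀ i ∉ T, q u i = 0).card := by
  set F := Finset.univ.filter fun u => EdgePair q v u ∧ ∀ i ∉ T, q u i = 0 with hF
  let M := Submodule.span ℝ ((F.image fun u => q u - q v : Finset (I → ℝ)) : Set (I → ℝ))
  have hmem : ∀ b, (∀ i ∉ T, q b i = 0) → q b - q v ∈ M := by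
    intro b hb
    obtain ⟨c, -, hc, hs⟩ := h.exists_edge_coeff T hv hb
    rw [hs]
    refine Submodule.sum_mem _ fun u _ => ?_
    by_cases hu : c u = 0
    · simp [hu]
    · refine Submodule.smul_mem _ _ (Submodule.subset_span ?_)
      rw [Finset.coe_image]
      exact ⟨u, by simpa [hF] using hc u hu, rfl⟩
  have hsingle : ∀ i : T, (Pi.single i.1 1 : I → ℝ) ∈ M := by
    intro i
    have h1 := hmem (some (Sum.inl i.1)) (h.axis_face.2 i.2)
    have h2 := hmem none (by simp [h.origin])
    have h3 := M.sub_mem h1 h2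
    rwa [sub_sub_sub_cancel_right, h.origin, h.axis, sub_zero] at h3
  have hli : LinearIndependent ℝ fun i : T => (Pi.single i.1 1 : I → ℝ) :=
    (Pi.linearIndependent_single_one I ℝ).comp _ Subtype.val_injective
  calc T.card = Module.finrank ℝ
        (Submodule.span ℝ (Set.range fun i : T => (Pi.single i.1 1 : I → ℝ))) := by
        rw [finrank_span_eq_card hli, Fintype.card_coe]
    _ ≤ Module.finrank ℝ M := by
        refine Submodule.finrank_mono (Submodule.span_le.2 ?_)
        rintro _ ⟨i, rfl⟩
        exact hsingle i
    _ ≤ (F.image fun u => q u - q v).card := finrank_span_finset_le_card _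
    _ ≤ F.card := Finset.card_image_le

open Classical in
theorem card_nonadj_le (h : SimpleAtOrigin q) {j : J} {T : Finset I} (hT : support q j ⊆ T) :
    (T.filter fun i => ¬ EdgePair q (some (Sum.inr j)) (some (Sum.inl i))).card
      + (Finset.univ.filter fun l => support q l ⊆ T ∧
          ¬ EdgePair q (some (Sum.inr j)) (some (Sum.inr l))).card
      ≤ (Finset.univ.filter fun l => support q l ⊆ T).card := by
  have h1 := h.card_le_face_degree T (support_subset_iff.1 hT)
  rw [card_filter_option_sum, if_neg fun e => h.not_edge j e.1.symm] at h1
  simp only [h.axis_face, ← support_subset_iff] at h1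
  have h2 := Finset.card_filter_add_card_filter_not (s := T)
    (fun i => EdgePair q (some (Sum.inr j)) (some (Sum.inl i)))
  have h3 := Finset.card_filter_add_card_filter_not
    (s := Finset.univ.filter fun l => support q l ⊆ T)
    (fun l => EdgePair q (some (Sum.inr j)) (some (Sum.inr l)))
  rw [Finset.filter_filter, Finset.filter_filter] at h3
  have h4 : (T.filter fun i => EdgePair q (some (Sum.inr j)) (some (Sum.inl i)))
      = Finset.univ.filter fun i => EdgePair q (some (Sum.inr j)) (some (Sum.inl i)) ∧ i ∈ T := by
    ext i
    simp [and_comm]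
  have h5 : (Finset.univ.filter fun l => support q l ⊆ T ∧
        EdgePair q (some (Sum.inr j)) (some (Sum.inr l)))
      = Finset.univ.filter fun l => EdgePair q (some (Sum.inr j)) (some (Sum.inr l)) ∧
        support q l ⊆ T := by
    ext l
    simp [and_comm]
  rw [h4] at h2
  rw [h5] at h3
  omega

theorem exists_support_subset_insert (h : SimpleAtOrigin q) {j : J} {i : I}
    (hi : ¬ EdgePair q (some (Sum.inr j)) (some (Sum.inl i))) :
    ∃ l, l ≠ j ∧ support q l ⊆ insert i (support q j) := by
  classical
  by_contra! hcon
  have h1 := h.card_nonadj_le (Finset.subset_insert i (support q j))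
  have h2 : (Finset.univ.filter fun l => support q l ⊆ insert i (support q j)) ⊆ {j} := by
    intro l hl
    by_contra hlj
    exact hcon l (by simpa using hlj) (by simpa using hl)
  have h3 := Finset.card_le_card h2
  have h4 : 0 < ((insert i (support q j)).filter fun i =>
      ¬ EdgePair q (some (Sum.inr j)) (some (Sum.inl i))).card :=
    Finset.card_pos.2 ⟨i, by simp [hi]⟩
  have h5 : 0 < (Finset.univ.filter fun l => support q l ⊆ insert i (support q j) ∧
          ¬ EdgePair q (some (Sum.inr j)) (some (Sum.inr l))).card :=
    Finset.card_pos.2 ⟨j, by simp [not_edgePair_self]⟩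
  rw [Finset.card_singleton] at h3
  omega

theorem exists_third_support_subset (h : SimpleAtOrigin q) {j l : J} {i : I} {T : Finset I}
    (hjl : j ≠ l) (hj : support q j ⊆ T) (hl : support q l ⊆ T) (hiT : i ∈ T)
    (hi : ¬ EdgePair q (some (Sum.inr j)) (some (Sum.inl i)))
    (hn : ¬ EdgePair q (some (Sum.inr j)) (some (Sum.inr l))) :
    ∃ m, m ≠ j ∧ m ≠ l ∧ support q m ⊆ T := by
  classical
  by_contra! hcon
  have h1 := h.card_nonadj_le hj
  have h2 : (Finset.univ.filter fun l => support q l ⊆ T) ⊆ {j, l} := by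
    intro m hm
    by_contra hmj
    simp only [Finset.mem_insert, Finset.mem_singleton, not_or] at hmj
    exact hcon m hmj.1 hmj.2 (by simpa using hm)
  have h3 := Finset.card_le_card h2
  have h4 : 0 < (T.filter fun i =>
      ¬ EdgePair q (some (Sum.inr j)) (some (Sum.inl i))).card :=
    Finset.card_pos.2 ⟨i, by simp [hi, hiT]⟩
  have h5 : ({j, l} : Finset J) ⊆ Finset.univ.filter fun l => support q l ⊆ T ∧
          ¬ EdgePair q (some (Sum.inr j)) (some (Sum.inr l)) := by
    intro m hm
    simp only [Finset.mem_insert, Finset.mem_singleton] at hm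
    rcases hm with rfl | rfl
    · simp [hj, not_edgePair_self]
    · simp [hl, hn]
  have h6 := Finset.card_le_card h5
  rw [Finset.card_pair hjl] at h3 h6
  omega

open Classical in
/-- A vertex `y j` misses at most `card J - 1` of the other vertices apart from the origin. -/
theorem card_nonadj_lt (h : SimpleAtOrigin q) (j : J) :
    (Finset.univ.filter fun i => ¬ EdgePair q (some (Sum.inr j)) (some (Sum.inl i))).card
      + (Finset.univ.filter fun l => l ≠ j ∧
          ¬ EdgePair q (some (Sum.inr j)) (some (Sum.inr l))).card + 1
      ≤ Fintype.card J := by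
  have h1 := h.card_nonadj_le (Finset.subset_univ (support q j))
  simp only [Finset.subset_univ, true_and, Finset.filter_true, Finset.card_univ] at h1
  have h2 : (Finset.univ.filter fun l => l ≠ j ∧
      ¬ EdgePair q (some (Sum.inr j)) (some (Sum.inr l))) = (Finset.univ.filter fun l =>
      ¬ EdgePair q (some (Sum.inr j)) (some (Sum.inr l))).erase j := by
    ext l
    simp
  have h3 : j ∈ Finset.univ.filter fun l =>
      ¬ EdgePair q (some (Sum.inr j)) (some (Sum.inr l)) := by simp [not_edgePair_self]
  have h4 := Finset.card_erase_add_one h3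
  rw [h2]
  omega

theorem one_lt_sum (h : SimpleAtOrigin q) (j : J) : 1 < ∑ i, q (some (Sum.inr j)) i := by
  by_contra! hle
  set r := fun i => q (some (Sum.inr j)) i with hr
  let c : Option (I ⊕ J) → ℝ := fun b => b.elim (1 - ∑ i, r i) (Sum.elim r 0)
  have hc := h.indep (some (Sum.inr j)) c
    (by rintro (_ | i | l)
        · exact sub_nonneg.2 hle
        · exact h.nonneg _ i
        · exact le_rfl)
    (by ext i
        simp [c, Fintype.sum_option, h.origin, h.axis, Pi.single_apply, hr])
  have h1 : ∀ i, r i = 0 := fun i => hc (some (Sum.inl i)) (by simp)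
  have h2 : 1 - ∑ i, r i = 0 := hc none (by simp)
  simp [h1] at h2

theorem two_le_card_support (h : SimpleAtOrigin q) (j : J) : 2 ≤ (support q j).card := by
  by_contra! hlt
  have hle : (support q j).card ≤ 1 := by omega
  have hne : ∃ i, i ∈ support q j := by
    by_contra! hcon
    have h1 := h.one_lt_sum j
    rw [Finset.sum_eq_zero fun i _ => not_not.1 fun hi => hcon i (mem_support.2 hi)] at h1
    linarith
  obtain ⟨i, hi⟩ := hne
  refine h.indep.not_collinear (a := none) (b := some (Sum.inl i)) (e := some (Sum.inr j))
    (by simp) (by simp) (by simp) (q (some (Sum.inr j)) i) ?_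
  ext i'
  rw [h.origin, h.axis]
  by_cases hii : i' = i
  · subst hii
    simp
  · have : q (some (Sum.inr j)) i' = 0 := by
      by_contra hne
      exact hii (Finset.card_le_one.1 hle _ (mem_support.2 hne) _ hi)
    simp [this, hii]

theorem exists_support_eq_pair (h : SimpleAtOrigin q) {i i' : I} (hii : i ≠ i')
    (hn : ¬ EdgePair q (some (Sum.inl i)) (some (Sum.inl i'))) : ∃ j, support q j = {i, i'} := by
  classical
  have h1 := h.card_le_face_degree {i, i'} (v := some (Sum.inl i)) (h.axis_face.2 (by simp))
  rw [card_filter_option_sum, Finset.card_pair hii] at h1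
  simp only [h.axis_face, ← support_subset_iff] at h1
  have h2 : (Finset.univ.filter fun u => EdgePair q (some (Sum.inl i)) (some (Sum.inl u)) ∧
      u ∈ ({i, i'} : Finset I)) = ∅ := by
    ext u
    simp only [Finset.mem_filter, Finset.mem_univ, true_and, Finset.mem_insert,
      Finset.mem_singleton, Finset.notMem_empty, iff_false, not_and, not_or]
    intro hu
    exact ⟨fun e => not_edgePair_self _ (e ▸ hu), fun e => hn (e ▸ hu)⟩
  rw [h2, Finset.card_empty] at h1
  have h3 : 0 < (Finset.univ.filter fun u => EdgePair q (some (Sum.inl i)) (some (Sum.inr u)) ∧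
      support q u ⊆ ({i, i'} : Finset I)).card := by
    split_ifs at h1 <;> omega
  obtain ⟨j, hj⟩ := Finset.card_pos.1 h3
  simp only [Finset.mem_filter, Finset.mem_univ, true_and] at hj
  refine ⟨j, Finset.eq_of_subset_of_card_le hj.2 ?_⟩
  rw [Finset.card_pair hii]
  exact h.two_le_card_support j

theorem not_edge_of_support_eq_pair (h : SimpleAtOrigin q) {j : J} {i i' : I} (hii : i ≠ i')
    (hj : support q j = {i, i'}) : ¬ EdgePair q (some (Sum.inl i)) (some (Sum.inl i')) := by
  classical
  intro he
  set r := fun i => q (some (Sum.inr j)) i with hr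
  have h0 : ∀ u, u ≠ i → u ≠ i' → r u = 0 := fun u => eq_zero_of_support_eq_pair hj
  have h1 := h.one_lt_sum j
  rw [Fintype.sum_eq_add i i' hii fun u hu => h0 u hu.1 hu.2] at h1
  let c : Option (I ⊕ J) → ℝ := fun b => b.elim (r i + r i' - 1) (Sum.elim 0 (Pi.single j 1))
  have hc := he.2 c (r i) (r i')
    (by rintro (_ | i | l)
        · exact sub_nonneg.2 h1.le
        · exact le_rfl
        · simp only [c, Option.elim, Sum.elim_inr, Pi.single_apply]
          split_ifs <;> norm_num)
    (h.nonneg _ _) (h.nonneg _ _)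
    (by simp [c, Fintype.sum_option])
    (by ext u
        simp only [c, Fintype.sum_option, h.origin, h.axis, Fintype.sum_sum_type, Option.elim,
          Sum.elim_inl, Sum.elim_inr, Pi.zero_apply, zero_smul, Finset.sum_const_zero, smul_zero,
          zero_add, Pi.single_apply, ite_smul, one_smul, Finset.sum_ite_eq', Finset.mem_univ,
          if_true, Pi.add_apply, Pi.smul_apply, smul_eq_mul]
        by_cases hu : u = i
        · subst hu
          simp [hii, hr]
        · by_cases hu' : u = i'
          · subst hu'
            simp [hu, hr]
          · simp [hu, hu', hr]
            exact h0 u hu hu')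
    (some (Sum.inr j)) (by simp) (by simp)
  simp [c] at hc

/-- Two points on triangular faces sharing the axis `a`: if they span with the axes a face without
further vertices, a missing edge from one to the far axis of the other orders their slopes. -/
theorem slope_le_of_not_edge (h : SimpleAtOrigin q) {j l : J} {a b c : I} (hjl : j ≠ l)
    (hab : a ≠ b) (hac : a ≠ c) (hbc : b ≠ c) (hj : support q j = {a, b})
    (hl : support q l = {a, c}) (honly : ∀ m, support q m ⊆ {a, b, c} → m = j ∨ m = l)
    (hn : ¬ EdgePair q (some (Sum.inr j)) (some (Sum.inl c))) :
    (1 - q (some (Sum.inr l)) c) * q (some (Sum.inr j)) a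
      ≤ (1 - q (some (Sum.inr j)) b) * q (some (Sum.inr l)) a := by
  have hjT : support q j ⊆ {a, b, c} := by rw [hj]; simp [Finset.insert_subset_iff]
  obtain ⟨e, he0, he, hs⟩ := h.exists_edge_coeff {a, b, c} (support_subset_iff.1 hjT)
    ((h.axis_face (i := c)).2 (by simp))
  have hnone : e none = 0 := by
    by_contra hne
    exact h.not_edge j (he _ hne).1.symm
  have hinl : ∀ i, i ≠ a ∧ i ≠ b → e (some (Sum.inl i)) = 0 := by
    intro i hi
    by_contra hne
    have h1 := he _ hne
    have h2 := h.axis_face.1 h1.2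
    simp only [Finset.mem_insert, Finset.mem_singleton, hi.1, hi.2, false_or] at h2
    exact hn (h2 ▸ h1.1)
  have hinr : ∀ m, m ≠ l → e (some (Sum.inr m)) = 0 := by
    intro m hm
    by_contra hne
    have h1 := he _ hne
    rcases honly m (support_subset_iff.2 h1.2) with rfl | rfl
    · exact h1.1.1 rfl
    · exact hm rfl
  rw [Fintype.sum_option, Fintype.sum_sum_type, hnone, zero_smul, zero_add,
    Fintype.sum_eq_add a b hab fun i hi => by rw [hinl i hi, zero_smul],
    Fintype.sum_eq_single l fun m hm => by rw [hinr m hm, zero_smul]] at hs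
  have hwj := h.one_lt_sum j
  have hwl := h.one_lt_sum l
  rw [Fintype.sum_eq_add a b hab fun i hi => eq_zero_of_support_eq_pair hj hi.1 hi.2] at hwj
  rw [Fintype.sum_eq_add a c hac fun i hi => eq_zero_of_support_eq_pair hl hi.1 hi.2] at hwl
  have hjc := eq_zero_of_support_eq_pair hj hac.symm hbc.symm
  have hlb := eq_zero_of_support_eq_pair hl hab.symm hbc
  have hul := h.pos_of_mem_support (j := l) (i := a) (by rw [hl]; simp)
  have hlc := h.pos_of_mem_support (j := l) (i := c) (by rw [hl]; simp)
  have hα := he0 (some (Sum.inl a))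
  have sa := congrFun hs a
  have sb := congrFun hs b
  have sc := congrFun hs c
  simp only [h.axis, Pi.add_apply, Pi.sub_apply, Pi.smul_apply, smul_eq_mul, Pi.single_apply, hab,
    hab.symm, hac, hac.symm, hbc, hbc.symm, if_true, if_false, hjc, hlb] at sa sb sc
  generalize q (some (Sum.inr j)) a = u at *
  generalize q (some (Sum.inr j)) b = w at *
  generalize q (some (Sum.inr l)) a = r at *
  generalize q (some (Sum.inr l)) c = s at *
  generalize e (some (Sum.inl a)) = α at *
  generalize e (some (Sum.inl b)) = β at *
  generalize e (some (Sum.inr l)) = γ at *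
  have h1 : γ * s = 1 := by linarith
  have h2 : (u + w - 1) * (α + β + γ - 1) = 1 - γ * (1 - r) := by linarith
  have h3 : u * (α + β + γ - 1) = α + γ * r := by linarith
  have h4 : (u + w - 1) * (α + β + γ - 1) * s = s + r - 1 := by
    rw [h2]; linear_combination (r - 1) * h1
  have h5 : (u + w - 1) * r ≤ u * (s + r - 1) := by
    have h6 : (u + w - 1) * (u * (α + β + γ - 1)) * s = u * (s + r - 1) := by
      rw [← h4]; ring
    have h7 : (u + w - 1) * (α + γ * r) * s = (u + w - 1) * α * s + (u + w - 1) * r := by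
      linear_combination (u + w - 1) * r * h1
    rw [← h6, h3, h7]
    have : 0 ≤ (u + w - 1) * α * s :=
      mul_nonneg (mul_nonneg (by linarith) hα) hlc.le
    linarith
  nlinarith

theorem not_edge_of_slope_le (h : SimpleAtOrigin q) {j l : J} {a b c : I} (hjl : j ≠ l)
    (hab : a ≠ b) (hac : a ≠ c) (hbc : b ≠ c) (hj : support q j = {a, b})
    (hl : support q l = {a, c})
    (hle : (1 - q (some (Sum.inr l)) c) * q (some (Sum.inr j)) a
      ≤ (1 - q (some (Sum.inr j)) b) * q (some (Sum.inr l)) a) :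
    ¬ EdgePair q (some (Sum.inr j)) (some (Sum.inl c)) := by
  classical
  intro he
  have huj := h.pos_of_mem_support (j := j) (i := a) (by rw [hj]; simp)
  have hwj := h.pos_of_mem_support (j := j) (i := b) (by rw [hj]; simp)
  have hul := h.pos_of_mem_support (j := l) (i := a) (by rw [hl]; simp)
  have hjc : ∀ i, i ≠ a → i ≠ b → q (some (Sum.inr j)) i = 0 := fun i =>
    eq_zero_of_support_eq_pair hj
  have hlb : ∀ i, i ≠ a → i ≠ c → q (some (Sum.inr l)) i = 0 := fun i =>
    eq_zero_of_support_eq_pair hl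
  set x := q (some (Sum.inr j)) with hx
  set y := q (some (Sum.inr l)) with hy
  let e : Option (I ⊕ J) → ℝ := fun v => v.elim (y a + x a * y c - x a - y a * x b)
    (Sum.elim (Pi.single b (y a * x b)) (Pi.single l (x a)))
  have hc := he.2 e (y a) (x a * y c)
    (by rintro (_ | i | m)
        · simp only [e, Option.elim]; linarith
        · simp only [e, Option.elim, Sum.elim_inl, Pi.single_apply]
          split_ifs
          · positivity
          · exact le_rfl
        · simp only [e, Option.elim, Sum.elim_inr, Pi.single_apply]
          split_ifs
          · exact huj.le
          · exact le_rfl)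
    hul.le (mul_nonneg huj.le (h.nonneg _ _))
    (by simp only [e, Fintype.sum_option, Fintype.sum_sum_type, Option.elim, Sum.elim_inl,
          Sum.elim_inr, Pi.single_apply, Finset.sum_ite_eq', Finset.mem_univ, if_true]
        ring)
    (by ext i
        simp only [e, Fintype.sum_option, Fintype.sum_sum_type, Option.elim, Sum.elim_inl,
          Sum.elim_inr, Pi.single_apply, ite_smul, zero_smul, Finset.sum_ite_eq', Finset.mem_univ,
          if_true, h.origin, h.axis, smul_zero, Pi.add_apply, Pi.smul_apply, smul_eq_mul,
          ← hx, ← hy]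
        by_cases hia : i = a
        · subst hia
          simp [hab, hac]
          ring
        by_cases hib : i = b
        · subst hib
          simp [hbc, hlb i hia hbc]
        by_cases hic : i = c
        · subst hic
          simp [hib, hjc i hia hib]
        simp [hib, hic, hlb i hia hic, hjc i hia hib])
    (some (Sum.inr l)) (by simpa using hjl.symm) (by simp)
  simp only [e, Option.elim, Sum.elim_inr, Pi.single_eq_same] at hc
  exact huj.ne' hc

theorem not_edge_trans (h : SimpleAtOrigin q) {j k m : J} {a b c d : I}
    (hjk : j ≠ k) (hkm : k ≠ m) (hjm : j ≠ m) (huniv : ∀ l, l = j ∨ l = k ∨ l = m)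
    (hab : a ≠ b) (hac : a ≠ c) (had : a ≠ d) (hbc : b ≠ c) (hbd : b ≠ d) (hcd : c ≠ d)
    (hj : support q j = {a, b}) (hk : support q k = {a, c}) (hm : support q m = {a, d})
    (h1 : ¬ EdgePair q (some (Sum.inr j)) (some (Sum.inl c)))
    (h2 : ¬ EdgePair q (some (Sum.inr k)) (some (Sum.inl d))) :
    ¬ EdgePair q (some (Sum.inr j)) (some (Sum.inl d)) := by
  refine h.not_edge_of_slope_le hjm hab had hbd hj hm ?_
  have e1 := h.slope_le_of_not_edge hjk hab hac hbc hj hk (fun l hl => by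
    rcases huniv l with rfl | rfl | rfl
    · exact Or.inl rfl
    · exact Or.inr rfl
    · rw [hm] at hl
      have := hl (Finset.mem_insert_of_mem (Finset.mem_singleton_self d))
      simp [had.symm, hbd.symm, hcd.symm] at this) h1
  have e2 := h.slope_le_of_not_edge hkm hac had hcd hk hm (fun l hl => by
    rcases huniv l with rfl | rfl | rfl
    · rw [hj] at hl
      have := hl (Finset.mem_insert_of_mem (Finset.mem_singleton_self b))
      simp [hab.symm, hbd, hbc] at this
    · exact Or.inl rfl
    · exact Or.inr rfl) h2
  have huj := h.pos_of_mem_support (j := j) (i := a) (by rw [hj]; simp)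
  have huk := h.pos_of_mem_support (j := k) (i := a) (by rw [hk]; simp)
  have hum := h.pos_of_mem_support (j := m) (i := a) (by rw [hm]; simp)
  refine le_of_mul_le_mul_right ?_ huk
  have e3 := mul_le_mul_of_nonneg_right e1 hum.le
  have e4 := mul_le_mul_of_nonneg_right e2 huj.le
  linarith

/-- Three points on consecutive triangular faces cannot all fail to be joined in the way the
hypotheses require. -/
theorem edge_of_path (h : SimpleAtOrigin q) {j k m : J} {a b c d : I}
    (hjm : j ≠ m) (huniv : ∀ l, l = j ∨ l = k ∨ l = m)
    (hab : a ≠ b) (hac : a ≠ c) (had : a ≠ d) (hbc : b ≠ c) (hbd : b ≠ d) (hcd : c ≠ d)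
    (hj : support q j = {a, b}) (hk : support q k = {a, c}) (hm : support q m = {b, d})
    (h1 : ¬ EdgePair q (some (Sum.inr j)) (some (Sum.inl d)))
    (h2 : ¬ EdgePair q (some (Sum.inr k)) (some (Sum.inl b)))
    (h3 : ¬ EdgePair q (some (Sum.inr k)) (some (Sum.inr m))) : False := by
  have e1 := h.slope_le_of_not_edge hjm hab.symm hbd had (by rw [hj, Finset.pair_comm]) hm
    (fun l hl => by
      rcases huniv l with rfl | rfl | rfl
      · exact Or.inl rfl
      · rw [hk] at hl
        have := hl (Finset.mem_insert_of_mem (Finset.mem_singleton_self c))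
        simp [hac.symm, hbc.symm, hcd] at this
      · exact Or.inr rfl) h1
  have hkT : support q k ⊆ {a, b, c, d} := by rw [hk]; simp [Finset.insert_subset_iff]
  have hmT : support q m ⊆ {a, b, c, d} := by rw [hm]; simp [Finset.insert_subset_iff]
  obtain ⟨e, he0, he, hs⟩ := h.exists_edge_coeff {a, b, c, d} (support_subset_iff.1 hkT)
    (support_subset_iff.1 hmT)
  have hnone : e none = 0 := by
    by_contra hne
    exact h.not_edge k (he _ hne).1.symm
  have hinl : ∀ i, i ∉ ({a, c, d} : Finset I) → e (some (Sum.inl i)) = 0 := by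
    intro i hi
    by_contra hne
    have hi1 := he _ hne
    have hi2 := h.axis_face.1 hi1.2
    simp only [Finset.mem_insert, Finset.mem_singleton, not_or] at hi hi2
    simp only [hi, false_or, or_false] at hi2
    exact h2 (hi2 ▸ hi1.1)
  have hinr : ∀ l, l ≠ j → e (some (Sum.inr l)) = 0 := by
    intro l hl
    by_contra hne
    have hi1 := he _ hne
    rcases huniv l with rfl | rfl | rfl
    · exact hl rfl
    · exact hi1.1.1 rfl
    · exact h3 hi1.1
  rw [Fintype.sum_option, Fintype.sum_sum_type, hnone, zero_smul, zero_add,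
    ← Finset.sum_subset (Finset.subset_univ {a, c, d})
      (fun i _ hi => by rw [hinl i hi, zero_smul]),
    Fintype.sum_eq_single j fun m hm => by rw [hinr m hm, zero_smul],
    Finset.sum_insert (by simp [hac, had]), Finset.sum_pair hcd] at hs
  have hwk := h.one_lt_sum k
  rw [Fintype.sum_eq_add a c hac fun i hi => eq_zero_of_support_eq_pair hk hi.1 hi.2] at hwk
  have hja := h.pos_of_mem_support (j := j) (i := a) (by rw [hj]; simp)
  have hjb := h.pos_of_mem_support (j := j) (i := b) (by rw [hj]; simp)
  have hka := h.pos_of_mem_support (j := k) (i := a) (by rw [hk]; simp)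
  have hmb := h.pos_of_mem_support (j := m) (i := b) (by rw [hm]; simp)
  have hα := he0 (some (Sum.inl a))
  have hjc := eq_zero_of_support_eq_pair hj hac.symm hbc.symm
  have hjd := eq_zero_of_support_eq_pair hj had.symm hbd.symm
  have hkb := eq_zero_of_support_eq_pair hk hab.symm hbc
  have hkd := eq_zero_of_support_eq_pair hk had.symm hcd.symm
  have hma := eq_zero_of_support_eq_pair hm hab had
  have hmc := eq_zero_of_support_eq_pair hm hbc.symm hcd
  have sa := congrFun hs a
  have sb := congrFun hs b
  have sc := congrFun hs c
  have sd := congrFun hs d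
  simp only [h.axis, Pi.add_apply, Pi.sub_apply, Pi.smul_apply, smul_eq_mul, Pi.single_apply,
    hab.symm, hac, hac.symm, had, had.symm, hbc, hbd, hcd, hcd.symm, if_true,
    if_false, hjc, hjd, hkb, hkd, hma, hmc] at sa sb sc sd
  generalize q (some (Sum.inr j)) a = u at *
  generalize q (some (Sum.inr j)) b = w at *
  generalize q (some (Sum.inr k)) a = x at *
  generalize q (some (Sum.inr k)) c = y at *
  generalize q (some (Sum.inr m)) b = r at *
  generalize q (some (Sum.inr m)) d = s at *
  generalize e (some (Sum.inl a)) = A at *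
  generalize e (some (Sum.inl c)) = C at *
  generalize e (some (Sum.inl d)) = D at *
  generalize e (some (Sum.inr j)) = Y at *
  have t1 : D = s := by linarith
  have t2 : Y * w = r := by linarith
  have t3 : A + Y * u = x * (A + C + D + Y - 1) := by linarith
  have t4 : (x + y - 1) * (A + C + D + Y - 1) = 1 - s - Y * (1 - u) := by
    rw [← t1]; linarith
  have hY : 0 < Y := by
    by_contra! hle
    nlinarith
  have t5 : (1 - s - Y * (1 - u)) * w ≤ 0 := by
    have : (1 - s - Y * (1 - u)) * w = (1 - s) * w - (1 - u) * r := by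
      rw [← t2]; ring
    rw [this]; linarith
  have t6 : 1 - s - Y * (1 - u) ≤ 0 := by
    by_contra! hlt
    exact absurd (mul_pos hlt hjb) (not_lt.2 t5)
  have t7 : 0 < A + C + D + Y - 1 := by
    have : 0 < x * (A + C + D + Y - 1) := by
      rw [← t3]
      have := mul_pos hY hja
      linarith
    exact (mul_pos_iff_of_pos_left hka).1 this
  have t8 : 0 < (x + y - 1) * (A + C + D + Y - 1) := mul_pos (by linarith) t7
  linarith

open Classical in
/-- The case of three triangular faces sharing the axis `a`. -/
theorem false_of_star (h : SimpleAtOrigin q) {j k m : J} {a b c d : I}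
    (hjk : j ≠ k) (hkm : k ≠ m) (hjm : j ≠ m) (huniv : ∀ l, l = j ∨ l = k ∨ l = m)
    (hab : a ≠ b) (hac : a ≠ c) (had : a ≠ d) (hbc : b ≠ c) (hbd : b ≠ d) (hcd : c ≠ d)
    (hj : support q j = {a, b}) (hk : support q k = {a, c}) (hm : support q m = {a, d})
    (h1 : ¬ EdgePair q (some (Sum.inr j)) (some (Sum.inl c)))
    (h2 : ¬ EdgePair q (some (Sum.inr j)) (some (Sum.inl d)))
    (hsum : (nonadjAxes q k).card + (nonadjAxes q m).card
      + (if EdgePair q (some (Sum.inr k)) (some (Sum.inr m)) then 0 else 1) = 3) : False := by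
  have hkA : nonadjAxes q k ⊆ {b, d} := by
    intro i hi
    obtain ⟨l, hlk, hl⟩ := h.exists_support_subset_insert (mem_nonadjAxes.1 hi)
    rw [hk] at hl
    rcases huniv l with rfl | rfl | rfl
    · have := hl (by rw [hj]; simp : b ∈ _)
      simp only [Finset.mem_insert, Finset.mem_singleton, hab.symm, hbc, or_false] at this
      simp [this]
    · exact absurd rfl hlk
    · have := hl (by rw [hm]; simp : d ∈ _)
      simp only [Finset.mem_insert, Finset.mem_singleton, had.symm, hcd.symm, or_false] at this
      simp [this]
  have hmA : nonadjAxes q m ⊆ {b, c} := by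
    intro i hi
    obtain ⟨l, hlm, hl⟩ := h.exists_support_subset_insert (mem_nonadjAxes.1 hi)
    rw [hm] at hl
    rcases huniv l with rfl | rfl | rfl
    · have := hl (by rw [hj]; simp : b ∈ _)
      simp only [Finset.mem_insert, Finset.mem_singleton, hab.symm, hbd, or_false] at this
      simp [this]
    · have := hl (by rw [hk]; simp : c ∈ _)
      simp only [Finset.mem_insert, Finset.mem_singleton, hac.symm, hcd, or_false] at this
      simp [this]
    · exact absurd rfl hlm
  have hkc : (nonadjAxes q k).card
      = (if b ∈ nonadjAxes q k then 1 else 0) + if d ∈ nonadjAxes q k then 1 else 0 := by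
    rw [← Finset.sum_pair hbd (f := fun i => if i ∈ nonadjAxes q k then 1 else 0),
      ← Finset.card_filter, Finset.filter_mem_eq_inter, Finset.inter_eq_right.2 hkA]
  have hmc : (nonadjAxes q m).card
      = (if b ∈ nonadjAxes q m then 1 else 0) + if c ∈ nonadjAxes q m then 1 else 0 := by
    rw [← Finset.sum_pair hbc (f := fun i => if i ∈ nonadjAxes q m then 1 else 0),
      ← Finset.card_filter, Finset.filter_mem_eq_inter, Finset.inter_eq_right.2 hmA]
  rw [hkc, hmc] at hsum
  simp only [mem_nonadjAxes] at hsum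
  have hkT : support q k ⊆ {a, c, d} := by rw [hk]; simp [Finset.insert_subset_iff]
  have hmT : support q m ⊆ {a, c, d} := by rw [hm]; simp [Finset.insert_subset_iff]
  have hno : ∀ l, l ≠ k → l ≠ m → ¬ support q l ⊆ {a, c, d} := by
    intro l hlk hlm hl
    obtain rfl : l = j := by
      rcases huniv l with rfl | rfl | rfl
      exacts [rfl, absurd rfl hlk, absurd rfl hlm]
    have := hl (by rw [hj]; simp : b ∈ _)
    simp [hab.symm, hbc, hbd] at this
  have r1 : ¬ EdgePair q (some (Sum.inr k)) (some (Sum.inl d)) →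
      EdgePair q (some (Sum.inr k)) (some (Sum.inr m)) := by
    intro hd
    by_contra hn
    obtain ⟨l, hl1, hl2, hl⟩ := h.exists_third_support_subset hkm hkT hmT (by simp) hd hn
    exact hno l hl1 hl2 hl
  have r2 : ¬ EdgePair q (some (Sum.inr m)) (some (Sum.inl c)) →
      EdgePair q (some (Sum.inr k)) (some (Sum.inr m)) := by
    intro hd
    by_contra hn
    obtain ⟨l, hl1, hl2, hl⟩ := h.exists_third_support_subset hkm.symm hmT hkT (by simp) hd
      fun e => hn e.symm
    exact hno l hl2 hl1 hl
  have t1 := fun e => h.not_edge_trans hjk.symm hjm hkm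
    (fun l => by have := huniv l; tauto) hac hab had hbc.symm hcd hbd hk hj hm e h2
  have t2 := fun e => h.not_edge_trans hjm.symm hjk hkm.symm
    (fun l => by have := huniv l; tauto) had hab hac hbd.symm
    hcd.symm hbc hm hj hk e h1
  have t3 := fun e e' => h.not_edge_trans hkm.symm hjk.symm hjm.symm
    (fun l => by have := huniv l; tauto) had hac hab
    hcd.symm hbd.symm hbc.symm hm hk hj e e'
  have t4 := fun e e' => h.not_edge_trans hkm hjm.symm hjk.symm
    (fun l => by have := huniv l; tauto) hac had hab
    hcd hbc.symm hbd.symm hk hm hj e e'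
  clear * - hsum r1 r2 t1 t2 t3 t4
  generalize EdgePair q (some (Sum.inr k)) (some (Sum.inl b)) = P₁ at *
  generalize EdgePair q (some (Sum.inr k)) (some (Sum.inl d)) = P₂ at *
  generalize EdgePair q (some (Sum.inr m)) (some (Sum.inl b)) = P₃ at *
  generalize EdgePair q (some (Sum.inr m)) (some (Sum.inl c)) = P₄ at *
  generalize EdgePair q (some (Sum.inr k)) (some (Sum.inr m)) = P₅ at *
  by_cases P₁ <;> by_cases P₂ <;> by_cases P₃ <;> by_cases P₄ <;> by_cases P₅ <;> simp_all

open Classical in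
/-- The case of three consecutive triangular faces. -/
theorem false_of_path (h : SimpleAtOrigin q) {j k m : J} {a b c d : I}
    (hjm : j ≠ m) (huniv : ∀ l, l = j ∨ l = k ∨ l = m)
    (hab : a ≠ b) (hac : a ≠ c) (had : a ≠ d) (hbc : b ≠ c) (hbd : b ≠ d) (hcd : c ≠ d)
    (hj : support q j = {a, b}) (hk : support q k = {a, c}) (hm : support q m = {b, d})
    (h1 : ¬ EdgePair q (some (Sum.inr j)) (some (Sum.inl d)))
    (hsum : (nonadjAxes q k).card + (nonadjAxes q m).card
      + (if EdgePair q (some (Sum.inr k)) (some (Sum.inr m)) then 0 else 1) = 3) : False := by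
  have hkA : nonadjAxes q k ⊆ {b} := by
    intro i hi
    obtain ⟨l, hlk, hl⟩ := h.exists_support_subset_insert (mem_nonadjAxes.1 hi)
    rw [hk] at hl
    have : b ∈ insert i ({a, c} : Finset I) := by
      rcases huniv l with rfl | rfl | rfl
      exacts [hl (by rw [hj]; simp), absurd rfl hlk, hl (by rw [hm]; simp)]
    simp only [Finset.mem_insert, Finset.mem_singleton, hab.symm, hbc, or_false] at this
    simp [this]
  have hmA : nonadjAxes q m ⊆ {a} := by
    intro i hi
    obtain ⟨l, hlk, hl⟩ := h.exists_support_subset_insert (mem_nonadjAxes.1 hi)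
    rw [hm] at hl
    have : a ∈ insert i ({b, d} : Finset I) := by
      rcases huniv l with rfl | rfl | rfl
      exacts [hl (by rw [hj]; simp), hl (by rw [hk]; simp), absurd rfl hlk]
    simp only [Finset.mem_insert, Finset.mem_singleton, hab, had, or_false] at this
    simp [this]
  have hk1 := Finset.card_le_card hkA
  have hm1 := Finset.card_le_card hmA
  rw [Finset.card_singleton] at hk1 hm1
  have hkb : b ∈ nonadjAxes q k := by
    rcases Finset.subset_singleton_iff.1 hkA with hA | hA
    · rw [hA, Finset.card_empty] at hsum
      split_ifs at hsum <;> omega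
    · simp [hA]
  refine h.edge_of_path hjm huniv hab hac had hbc hbd hcd hj hk hm h1 (mem_nonadjAxes.1 hkb)
    fun e => ?_
  rw [if_pos e] at hsum
  omega

open Classical in
/-- The case of three distinct triangular faces, one of whose vertices misses two axes. -/
theorem false_of_distinct_pairs (h : SimpleAtOrigin q) {j k m : J}
    (hjk : j ≠ k) (hkm : k ≠ m) (hjm : j ≠ m) (huniv : ∀ l, l = j ∨ l = k ∨ l = m)
    (hj2 : (support q j).card = 2) (hk2 : (support q k).card = 2) (hm2 : (support q m).card = 2)
    (hSjk : support q j ≠ support q k) (hSjm : support q j ≠ support q m)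
    (hA : (nonadjAxes q j).card = 2)
    (hsum : (nonadjAxes q k).card + (nonadjAxes q m).card
      + (if EdgePair q (some (Sum.inr k)) (some (Sum.inr m)) then 0 else 1) = 3) : False := by
  obtain ⟨c, d, hcd, hcdA⟩ := Finset.card_eq_two.1 hA
  have hc : ¬ EdgePair q (some (Sum.inr j)) (some (Sum.inl c)) :=
    mem_nonadjAxes.1 (by rw [hcdA]; simp)
  have hd : ¬ EdgePair q (some (Sum.inr j)) (some (Sum.inl d)) :=
    mem_nonadjAxes.1 (by rw [hcdA]; simp)
  -- it suffices to treat the case where `c` comes from `k` and `d` comes from `m`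
  suffices H : ∀ {k m : J} {c d : I}, j ≠ k → k ≠ m → j ≠ m → (∀ l, l = j ∨ l = k ∨ l = m) →
      (support q k).card = 2 → (support q m).card = 2 → support q j ≠ support q k →
      support q j ≠ support q m → c ≠ d →
      ¬ EdgePair q (some (Sum.inr j)) (some (Sum.inl c)) →
      ¬ EdgePair q (some (Sum.inr j)) (some (Sum.inl d)) →
      support q k ⊆ insert c (support q j) → support q m ⊆ insert d (support q j) →
      (nonadjAxes q k).card + (nonadjAxes q m).card
        + (if EdgePair q (some (Sum.inr k)) (some (Sum.inr m)) then 0 else 1) = 3 → False by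
    have hboth : ∀ l, (support q l).card = 2 → support q j ≠ support q l →
        support q l ⊆ insert c (support q j) → support q l ⊆ insert d (support q j) → False := by
      intro l hl hne hc hd
      refine hne (Finset.eq_of_subset_of_card_le (fun i hi => ?_) (by omega)).symm
      have h1 := hc hi
      have h2 := hd hi
      rw [Finset.mem_insert] at h1 h2
      rcases h1 with rfl | h1
      · exact h2.resolve_left hcd
      · exact h1
    obtain ⟨l, hlj, hl⟩ := h.exists_support_subset_insert hc
    obtain ⟨l', hlj', hl'⟩ := h.exists_support_subset_insert hd
    rcases huniv l with rfl | rfl | rfl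
    · exact hlj rfl
    · rcases huniv l' with rfl | rfl | rfl
      · exact hlj' rfl
      · exact hboth _ hk2 hSjk hl hl'
      · exact H hjk hkm hjm huniv hk2 hm2 hSjk hSjm hcd hc hd hl hl' hsum
    · rcases huniv l' with rfl | rfl | rfl
      · exact hlj' rfl
      · exact H hjk hkm hjm huniv hk2 hm2 hSjk hSjm hcd.symm hd hc hl' hl hsum
      · exact hboth _ hm2 hSjm hl hl'
  clear hsum hkm hjm huniv hk2 hm2 hSjk hSjm hjk hc hd hcd hcdA
  clear c d k m
  intro k m c d hjk hkm hjm huniv hk2 hm2 hSjk hSjm hcd hc hd hk hm hsum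
  have hnot : ∀ {l : J} {i : I}, (support q l).card = 2 → support q j ≠ support q l →
      support q l ⊆ insert i (support q j) →
      i ∉ support q j ∧ ∃ a ∈ support q j, support q l = {a, i} := by
    intro l i hl2 hne hl
    have hi : i ∉ support q j := by
      intro hi
      rw [Finset.insert_eq_of_mem hi] at hl
      exact hne (Finset.eq_of_subset_of_card_le hl (by omega)).symm
    have hil : i ∈ support q l := by
      by_contra hil
      rw [Finset.subset_insert_iff_of_notMem hil] at hl
      exact hne (Finset.eq_of_subset_of_card_le hl (by omega)).symm
    refine ⟨hi, ?_⟩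
    obtain ⟨a, ha⟩ := Finset.card_eq_one.1
      (by rw [Finset.card_erase_of_mem hil, hl2] : ((support q l).erase i).card = 1)
    have ha' : a ∈ (support q l).erase i := by rw [ha]; simp
    rw [Finset.mem_erase] at ha'
    refine ⟨a, (Finset.mem_insert.1 (hl ha'.2)).resolve_left ha'.1, ?_⟩
    rw [← Finset.insert_erase hil, ha, Finset.pair_comm]
  obtain ⟨hcj, a, haj, hka⟩ := hnot hk2 hSjk hk
  obtain ⟨hdj, a', haj', hma⟩ := hnot hm2 hSjm hm
  have hca : ∀ x ∈ support q j, x ≠ c := fun x hx e => hcj (e ▸ hx)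
  have hda : ∀ x ∈ support q j, x ≠ d := fun x hx e => hdj (e ▸ hx)
  by_cases haa : a = a'
  · subst haa
    obtain ⟨b, hb⟩ := Finset.card_eq_one.1
      (by rw [Finset.card_erase_of_mem haj, hj2] : ((support q j).erase a).card = 1)
    have hbj : b ∈ (support q j).erase a := by rw [hb]; simp
    rw [Finset.mem_erase] at hbj
    have hj : support q j = {a, b} := by rw [← Finset.insert_erase haj, hb]
    exact h.false_of_star hjk hkm hjm huniv hbj.1.symm (hca a haj) (hda a haj) (hca b hbj.2)
      (hda b hbj.2) hcd hj hka hma hc hd hsum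
  · have hj : support q j = {a, a'} := by
      refine (Finset.eq_of_subset_of_card_le ?_ ?_).symm
      · simp [Finset.insert_subset_iff, haj, haj']
      · rw [Finset.card_pair haa, hj2]
    exact h.false_of_path hjm huniv haa (hca a haj) (hda a haj) (hca a' haj') (hda a' haj') hcd hj
      hka hma hd hsum

/-- The case in which every vertex misses two axes and not all triangular faces are distinct. -/
theorem false_of_two_pairs (h : SimpleAtOrigin q) {j k m : J}
    (huniv : ∀ l, l = j ∨ l = k ∨ l = m)
    (hj2 : (support q j).card = 2) (hk2 : (support q k).card = 2)
    (hSjk : support q j ≠ support q k)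
    (hm : support q m = support q j ∨ support q m = support q k ∨ 3 ≤ (support q m).card)
    (hA : ∀ l, (nonadjAxes q l).card = 2) : False := by
  have hjk : ¬ support q j ⊆ support q k := fun hs =>
    hSjk (Finset.eq_of_subset_of_card_le hs (by omega))
  have hkj : ¬ support q k ⊆ support q j := fun hs =>
    hSjk (Finset.eq_of_subset_of_card_le hs (by omega)).symm
  have key : ∀ l, ∃ i i', i ≠ i' ∧
      (∃ u, u ≠ l ∧ support q u ⊆ insert i (support q l)) ∧
      ∃ u, u ≠ l ∧ support q u ⊆ insert i' (support q l) := by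
    intro l
    obtain ⟨i, i', hii, hl⟩ := Finset.card_eq_two.1 (hA l)
    exact ⟨i, i', hii,
      h.exists_support_subset_insert (mem_nonadjAxes.1 (by rw [hl]; simp)),
      h.exists_support_subset_insert (mem_nonadjAxes.1 (by rw [hl]; simp))⟩
  have hint : ∀ {i i' : I} {S T : Finset I}, i ≠ i' → S ⊆ insert i T → S ⊆ insert i' T →
      S ⊆ T := by
    intro i i' S T hii h1 h2 x hx
    have h3 := h1 hx
    have h4 := h2 hx
    rw [Finset.mem_insert] at h3 h4
    rcases h3 with rfl | h3
    · exact h4.resolve_left hii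
    · exact h3
  rcases hm with hm | hm | hm
  · obtain ⟨i, i', hii, ⟨u, hu, hus⟩, u', hu', hus'⟩ := key k
    have hS : ∀ u, u ≠ k → support q u = support q j := by
      intro u hu
      rcases huniv u with rfl | rfl | rfl
      exacts [rfl, absurd rfl hu, hm]
    rw [hS u hu] at hus
    rw [hS u' hu'] at hus'
    exact hjk (hint hii hus hus')
  · obtain ⟨i, i', hii, ⟨u, hu, hus⟩, u', hu', hus'⟩ := key j
    have hS : ∀ u, u ≠ j → support q u = support q k := by
      intro u hu
      rcases huniv u with rfl | rfl | rfl
      exacts [absurd rfl hu, rfl, hm]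
    rw [hS u hu] at hus
    rw [hS u' hu'] at hus'
    exact hkj (hint hii hus hus')
  · have aux : ∀ {j k : J}, (∀ l, l = j ∨ l = k ∨ l = m) → (support q j).card = 2 →
        ¬ support q k ⊆ support q j →
        ∃ i i', i ≠ i' ∧ support q k ⊆ insert i (support q j) ∧
          support q m = insert i' (support q j) := by
      intro j k huniv hj2 hkj
      obtain ⟨i, i', hii, ⟨u, hu, hus⟩, u', hu', hus'⟩ := key j
      have hmj : ¬ support q m ⊆ support q j := fun hs => by
        have := Finset.card_le_card hs
        omega
      have heq : ∀ x, support q m ⊆ insert x (support q j) →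
          support q m = insert x (support q j) := fun x hx =>
        Finset.eq_of_subset_of_card_le hx (by
          have := Finset.card_insert_le x (support q j)
          omega)
      rcases huniv u with rfl | rfl | rfl <;> rcases huniv u' with rfl | rfl | rfl
      · exact absurd rfl hu
      · exact absurd rfl hu
      · exact absurd rfl hu
      · exact absurd rfl hu'
      · exact absurd (hint hii hus hus') hkj
      · exact ⟨i, i', hii, hus, heq _ hus'⟩
      · exact absurd rfl hu'
      · exact ⟨i', i, hii.symm, hus', heq _ hus⟩
      · exact absurd (hint hii hus hus') hmj
    obtain ⟨i, i', hii, h1, h2⟩ := aux huniv hj2 hkj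
    obtain ⟨x, x', -, -, h3⟩ := aux (j := k) (k := j)  (fun l => by have := huniv l; tauto) hk2 hjk
    refine hkj (hint hii h1 ?_)
    rw [← h2, h3]
    exact Finset.subset_insert _ _

open Classical in
/-- The pairs of non-adjacent neighbours of the origin are the two-element supports. -/
theorem sum_card_nonadj_axes (h : SimpleAtOrigin q) :
    ∑ i, (Finset.univ.filter fun i' => i ≠ i' ∧
        ¬ EdgePair q (some (Sum.inl i)) (some (Sum.inl i'))).card
      = 2 * ((Finset.univ.filter fun j => (support q j).card = 2).image (support q)).card := by
  set D := (Finset.univ.filter fun j => (support q j).card = 2).image (support q) with hD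
  set N : Finset (I × I) := Finset.univ.filter fun x => x.1 ≠ x.2 ∧
    ¬ EdgePair q (some (Sum.inl x.1)) (some (Sum.inl x.2)) with hN
  have h1 : ∑ i, (Finset.univ.filter fun i' => i ≠ i' ∧
        ¬ EdgePair q (some (Sum.inl i)) (some (Sum.inl i'))).card = N.card := by
    simp only [hN, Finset.card_filter, Fintype.sum_prod_type]
  have h2 : N.card = ∑ S ∈ D, S.offDiag.card := by
    rw [← Finset.card_biUnion]
    · congr 1
      ext ⟨i, i'⟩
      simp only [hN, hD, Finset.mem_filter, Finset.mem_univ, true_and, Finset.mem_biUnion,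
        Finset.mem_image, Finset.mem_offDiag, exists_exists_and_eq_and]
      constructor
      · rintro ⟨hii, hn⟩
        obtain ⟨j, hj⟩ := h.exists_support_eq_pair hii hn
        exact ⟨j, by rw [hj, Finset.card_pair hii], by simp [hj], by simp [hj], hii⟩
      · rintro ⟨j, hj, hi, hi', hii⟩
        refine ⟨hii, h.not_edge_of_support_eq_pair hii (j := j) ?_⟩
        refine (Finset.eq_of_subset_of_card_le ?_ (by rw [hj, Finset.card_pair hii])).symm
        simp [Finset.insert_subset_iff, hi, hi']
    · intro S hS T hT hST
      refine Finset.disjoint_left.2 ?_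
      rintro ⟨i, i'⟩ h1 h2
      rw [Finset.mem_offDiag] at h1 h2
      have hpair : ∀ S ∈ D, i ∈ S → i' ∈ S → S = {i, i'} := by
        intro S hS hi hi'
        simp only [hD, Finset.mem_image, Finset.mem_filter, Finset.mem_univ, true_and] at hS
        obtain ⟨j, hj, rfl⟩ := hS
        refine (Finset.eq_of_subset_of_card_le ?_ (by rw [hj, Finset.card_pair h1.2.2])).symm
        simp [Finset.insert_subset_iff, hi, hi']
      exact hST ((hpair S hS h1.1 h1.2.1).trans (hpair T hT h2.1 h2.2.1).symm)
  rw [h1, h2, Finset.sum_const_nat (m := 2), mul_comm]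
  intro S hS
  simp only [hD, Finset.mem_image, Finset.mem_filter, Finset.mem_univ, true_and] at hS
  obtain ⟨j, hj, rfl⟩ := hS
  rw [Finset.offDiag_card, hj]

open Classical in
/-- The number of edges in terms of the numbers of missing edges. -/
theorem two_mul_card_edges (h : SimpleAtOrigin q) :
    2 * (edgeGraph q).edgeSet.ncard
      + ∑ i, (Finset.univ.filter fun i' => i ≠ i' ∧
          ¬ EdgePair q (some (Sum.inl i)) (some (Sum.inl i'))).card
      + 2 * ∑ j, (nonadjAxes q j).card
      + ∑ j, (Finset.univ.filter fun l => l ≠ j ∧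
          ¬ EdgePair q (some (Sum.inr j)) (some (Sum.inr l))).card
      + Fintype.card J
      = Fintype.card I + Fintype.card I ^ 2 + 2 * (Fintype.card I * Fintype.card J)
        + Fintype.card J ^ 2 := by
  have hdeg : ∀ v, (edgeGraph q).degree v = (Finset.univ.filter fun u => EdgePair q v u).card :=
    fun v => by
      rw [← SimpleGraph.card_neighborFinset_eq_degree, SimpleGraph.neighborFinset_eq_filter]
      rfl
  have hedges : 2 * (edgeGraph q).edgeSet.ncard = ∑ v, (edgeGraph q).degree v := by
    rw [SimpleGraph.sum_degrees_eq_twice_card_edges, Set.ncard_eq_toFinset_card']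
    rfl
  have hx : ∀ i, (Finset.univ.filter fun i' =>
        EdgePair q (some (Sum.inl i)) (some (Sum.inl i'))).card
      + (Finset.univ.filter fun i' => i ≠ i' ∧
          ¬ EdgePair q (some (Sum.inl i)) (some (Sum.inl i'))).card + 1 = Fintype.card I := by
    intro i
    have h1 := Finset.card_filter_add_card_filter_not (s := (Finset.univ : Finset I))
      (fun i' => EdgePair q (some (Sum.inl i)) (some (Sum.inl i')))
    have h2 : (Finset.univ.filter fun i' => i ≠ i' ∧
        ¬ EdgePair q (some (Sum.inl i)) (some (Sum.inl i'))) = (Finset.univ.filter fun i' =>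
        ¬ EdgePair q (some (Sum.inl i)) (some (Sum.inl i'))).erase i := by
      ext i'
      simp [eq_comm]
    have h3 := Finset.card_erase_add_one (s := Finset.univ.filter fun i' =>
      ¬ EdgePair q (some (Sum.inl i)) (some (Sum.inl i'))) (a := i) (by simp [not_edgePair_self])
    rw [Finset.card_univ] at h1
    rw [h2]
    omega
  have hy : ∀ j, (Finset.univ.filter fun l =>
        EdgePair q (some (Sum.inr j)) (some (Sum.inr l))).card
      + (Finset.univ.filter fun l => l ≠ j ∧
          ¬ EdgePair q (some (Sum.inr j)) (some (Sum.inr l))).card + 1 = Fintype.card J := by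
    intro j
    have h1 := Finset.card_filter_add_card_filter_not (s := (Finset.univ : Finset J))
      (fun l => EdgePair q (some (Sum.inr j)) (some (Sum.inr l)))
    have h2 : (Finset.univ.filter fun l => l ≠ j ∧
        ¬ EdgePair q (some (Sum.inr j)) (some (Sum.inr l))) = (Finset.univ.filter fun l =>
        ¬ EdgePair q (some (Sum.inr j)) (some (Sum.inr l))).erase j := by
      ext l
      simp
    have h3 := Finset.card_erase_add_one (s := Finset.univ.filter fun l =>
      ¬ EdgePair q (some (Sum.inr j)) (some (Sum.inr l))) (a := j) (by simp [not_edgePair_self])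
    rw [Finset.card_univ] at h1
    rw [h2]
    omega
  have hxy : ∀ j, (Finset.univ.filter fun i =>
        EdgePair q (some (Sum.inr j)) (some (Sum.inl i))).card + (nonadjAxes q j).card
      = Fintype.card I := by
    intro j
    have h1 := Finset.card_filter_add_card_filter_not (s := (Finset.univ : Finset I))
      (fun i => EdgePair q (some (Sum.inr j)) (some (Sum.inl i)))
    rw [Finset.card_univ] at h1
    exact h1
  have hswap : ∑ i, (Finset.univ.filter fun j =>
        EdgePair q (some (Sum.inl i)) (some (Sum.inr j))).card
      = ∑ j, (Finset.univ.filter fun i =>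
        EdgePair q (some (Sum.inr j)) (some (Sum.inl i))).card := by
    simp only [Finset.card_filter]
    rw [Finset.sum_comm]
    refine Finset.sum_congr rfl fun j _ => Finset.sum_congr rfl fun i _ => ?_
    exact if_congr ⟨EdgePair.symm, EdgePair.symm⟩ rfl rfl
  have hx' := Finset.sum_congr rfl fun i (_ : i ∈ Finset.univ) => hx i
  have hy' := Finset.sum_congr rfl fun j (_ : j ∈ Finset.univ) => hy j
  have hxy' := Finset.sum_congr rfl fun j (_ : j ∈ Finset.univ) => hxy j
  simp only [Finset.sum_add_distrib, Finset.sum_const, Finset.card_univ, smul_eq_mul,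
    mul_one] at hx' hy' hxy'
  have hnone : ∀ j, ¬ EdgePair q (some (Sum.inr j)) none := fun j e => h.not_edge j e.symm
  rw [hedges]
  simp only [hdeg, card_filter_option_sum, Fintype.sum_option, Fintype.sum_sum_type,
    Finset.sum_add_distrib, hswap, not_edgePair_self, h.edge_axis, h.not_edge,
    (h.edge_axis _).symm, hnone, if_true, if_false,
    Finset.filter_true, Finset.filter_false, Finset.card_empty, Finset.card_univ,
    Finset.sum_const, smul_eq_mul, mul_one]
  have e1 : Fintype.card I ^ 2 = Fintype.card I * Fintype.card I := sq _
  have e2 : Fintype.card J ^ 2 = Fintype.card J * Fintype.card J := sq _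
  have e3 : Fintype.card J * Fintype.card I = Fintype.card I * Fintype.card J := mul_comm _ _
  omega

theorem card_edges_lower_bound (h : SimpleAtOrigin q) (hI : Fintype.card I = 6) :
    42 + 11 * Fintype.card J ≤ 2 * (edgeGraph q).edgeSet.ncard + Fintype.card J ^ 2 := by
  classical
  have h1 := h.two_mul_card_edges
  rw [h.sum_card_nonadj_axes, hI] at h1
  have h2 : ((Finset.univ.filter fun j => (support q j).card = 2).image (support q)).card
      ≤ Fintype.card J := Finset.card_image_le.trans (Finset.card_filter_le _ _)
  have h3 := Finset.sum_le_sum fun j (_ : j ∈ Finset.univ) => h.card_nonadj_lt j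
  simp only [Finset.sum_add_distrib, Finset.sum_const, Finset.card_univ, smul_eq_mul,
    mul_one] at h3
  rw [← sq] at h3
  simp only [nonadjAxes] at h1
  omega

open Classical in
theorem card_edges_ne (h : SimpleAtOrigin q) (hI : Fintype.card I = 6)
    (hJ : Fintype.card J = 3) : (edgeGraph q).edgeSet.ncard ≠ 34 := by
  intro h34
  obtain ⟨j, k, m, hjk, hjm, hkm, huniv⟩ :=
    Finset.card_eq_three.1 ((Finset.card_univ (α := J)).trans hJ)
  have hl : ∀ l, l = j ∨ l = k ∨ l = m := fun l => by
    have := Finset.mem_univ l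
    rw [huniv] at this
    simpa using this
  set n : J → J → ℕ := fun j l =>
    if EdgePair q (some (Sum.inr j)) (some (Sum.inr l)) then 0 else 1 with hn
  have hnsymm : ∀ j l, n j l = n l j := fun j l =>
    if_congr ⟨EdgePair.symm, EdgePair.symm⟩ rfl rfl
  have hrow : ∀ j k m : J, j ≠ k → j ≠ m → k ≠ m → (∀ l, l = j ∨ l = k ∨ l = m) →
      (Finset.univ.filter fun l => l ≠ j ∧
        ¬ EdgePair q (some (Sum.inr j)) (some (Sum.inr l))).card = n j k + n j m := by
    intro j k m hjk hjm hkm hl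
    have : (Finset.univ.filter fun l => l ≠ j ∧
        ¬ EdgePair q (some (Sum.inr j)) (some (Sum.inr l)))
        = ({k, m} : Finset J).filter fun l =>
          ¬ EdgePair q (some (Sum.inr j)) (some (Sum.inr l)) := by
      ext l
      simp only [Finset.mem_filter, Finset.mem_univ, true_and, Finset.mem_insert,
        Finset.mem_singleton]
      refine and_congr_left fun _ => ⟨(hl l).resolve_left, ?_⟩
      rintro (rfl | rfl)
      exacts [hjk.symm, hjm.symm]
    rw [this, Finset.card_filter, Finset.sum_pair hkm]
    simp only [hn, ite_not]
  have h1 := h.two_mul_card_edges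
  have hbound := h.card_nonadj_lt
  change ∀ j, (nonadjAxes q j).card + _ + 1 ≤ _ at hbound
  have hbj := hbound j
  have hbk := hbound k
  have hbm := hbound m
  have hsum : ∀ f : J → ℕ, ∑ l, f l = f j + (f k + f m) := fun f => by
    rw [huniv, Finset.sum_insert (by simp [hjk, hjm]), Finset.sum_pair hkm]
  rw [hrow j k m hjk hjm hkm hl] at hbj
  rw [hrow k j m hjk.symm hkm hjm fun l => by have := hl l; tauto] at hbk
  rw [hrow m j k hjm.symm hkm.symm hjk fun l => by have := hl l; tauto] at hbm
  rw [h.sum_card_nonadj_axes, hsum, hsum, hrow j k m hjk hjm hkm hl,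
    hrow k j m hjk.symm hkm hjm (fun l => by have := hl l; tauto),
    hrow m j k hjm.symm hkm.symm hjk (fun l => by have := hl l; tauto), hI, hJ, h34] at h1
  rw [hJ] at hbj hbk hbm
  rw [hnsymm k j] at h1 hbk
  rw [hnsymm m j, hnsymm m k] at h1 hbm
  set D := (Finset.univ.filter fun j => (support q j).card = 2).image (support q) with hD
  set F : Finset J := Finset.univ.filter fun j => (support q j).card = 2 with hF
  have hDF : D.card ≤ F.card := Finset.card_image_le
  have hF3 : F.card ≤ 3 := by
    rw [← hJ]
    exact Finset.card_filter_le _ _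
  have hD23 : D.card = 2 ∨ D.card = 3 := by omega
  rcases hD23 with hD2 | hD3
  · have hA : ∀ l, (nonadjAxes q l).card = 2 := by
      intro l
      rcases hl l with rfl | rfl | rfl <;> omega
    obtain ⟨S, T, hST, hDST⟩ := Finset.card_eq_two.1 hD2
    have hmemD : ∀ l, support q l ∈ D ↔ (support q l).card = 2 := by
      intro l
      simp only [hD, Finset.mem_image, hF, Finset.mem_filter, Finset.mem_univ, true_and]
      constructor
      · rintro ⟨l', hl', e⟩
        rw [← e, hl']
      · exact fun e => ⟨l, e, rfl⟩
    have hS : S ∈ D := by simp [hDST]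
    have hT : T ∈ D := by simp [hDST]
    obtain ⟨s, hs, rfl⟩ := Finset.mem_image.1 hS
    obtain ⟨t, ht, rfl⟩ := Finset.mem_image.1 hT
    have hst : s ≠ t := fun e => hST (by rw [e])
    have hthird : ∃ u, ∀ l, l = s ∨ l = t ∨ l = u := by
      rcases hl s with rfl | rfl | rfl <;> rcases hl t with rfl | rfl | rfl
      · exact absurd rfl hst
      · exact ⟨m, fun l => by have := hl l; tauto⟩
      · exact ⟨k, fun l => by have := hl l; tauto⟩
      · exact ⟨m, fun l => by have := hl l; tauto⟩
      · exact absurd rfl hst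
      · exact ⟨j, fun l => by have := hl l; tauto⟩
      · exact ⟨k, fun l => by have := hl l; tauto⟩
      · exact ⟨j, fun l => by have := hl l; tauto⟩
      · exact absurd rfl hst
    obtain ⟨u, hu⟩ := hthird
    refine h.false_of_two_pairs hu ((hmemD s).1 hS) ((hmemD t).1 hT) hST ?_ hA
    by_cases hu2 : (support q u).card = 2
    · have := (hmemD u).2 hu2
      rw [hDST] at this
      simp only [Finset.mem_insert, Finset.mem_singleton] at this
      tauto
    · have := h.two_le_card_support u
      omega
  · have hF' : F = Finset.univ := Finset.eq_univ_of_card _ (by omega)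
    have hcard : ∀ l, (support q l).card = 2 := fun l => by
      have : l ∈ F := by simp [hF']
      simpa [hF] using this
    have hinj : Function.Injective (support q) := by
      have : Set.InjOn (support q) F := Finset.card_image_iff.1 (by rw [← hD]; omega)
      rw [hF', Finset.coe_univ] at this
      exact Set.injOn_univ.1 this
    have h2 : (nonadjAxes q j).card = 2 ∨ (nonadjAxes q k).card = 2
        ∨ (nonadjAxes q m).card = 2 := by omega
    have hcon : ∀ j k m : J, j ≠ k → k ≠ m → j ≠ m → (∀ l, l = j ∨ l = k ∨ l = m) →
        (nonadjAxes q j).card = 2 →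
        (nonadjAxes q k).card + (nonadjAxes q m).card + n k m = 3 → False :=
      fun j k m hjk hkm hjm hl hA hsum => h.false_of_distinct_pairs hjk hkm hjm hl (hcard j)
        (hcard k) (hcard m) (hinj.ne hjk) (hinj.ne hjm) hA hsum
    rcases h2 with h2 | h2 | h2
    · exact hcon j k m hjk hkm hjm hl h2 (by omega)
    · exact hcon k j m hjk.symm hjm hkm (fun l => by have := hl l; tauto) h2 (by omega)
    · exact hcon m j k hjm.symm hjk hkm.symm (fun l => by have := hl l; tauto) h2 (by omega)

end SimpleAtOrigin

/-- Either no vertex of a 6-polytope is simple, or the polytope is subject to the bounds coming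
from a simple vertex. -/
theorem ConvexlyIndependent.card_edges_of_finrank_eq_six {W E : Type*} [Fintype W]
    [AddCommGroup E] [Module ℝ E] {p : W → E} (hp : ConvexlyIndependent p)
    (hd : Module.finrank ℝ (vectorSpan ℝ (Set.range p)) = 6) {k : ℕ}
    (hk : Fintype.card W = 7 + k) :
    7 * (7 + k) ≤ 2 * (edgeGraph p).edgeSet.ncard ∨
      42 + 11 * k ≤ 2 * (edgeGraph p).edgeSet.ncard + k ^ 2 ∧
        (k = 3 → (edgeGraph p).edgeSet.ncard ≠ 34) := by
  classical
  by_cases hsimple : ∃ a, (edgeGraph p).degree a = 6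
  · right
    obtain ⟨a, ha⟩ := hsimple
    obtain ⟨q, σ, h, hσ⟩ := hp.exists_simpleAtOrigin a hd ha
    have hI : Fintype.card {u // EdgePair p a u} = 6 := by
      rw [← ha, ← SimpleGraph.card_neighborSet_eq_degree]
      rfl
    have hJ : Fintype.card {u // u ≠ a ∧ ¬ EdgePair p a u} = k := by
      have := Fintype.card_congr σ
      rw [Fintype.card_option, Fintype.card_sum, hI, hk] at this
      omega
    have hf : (edgeGraph q).edgeSet.ncard = (edgeGraph p).edgeSet.ncard := by
      let φ : edgeGraph q ≃g edgeGraph p := ⟨σ, fun {b b'} => (hσ b b').symm⟩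
      exact Nat.card_congr φ.mapEdgeSet
    rw [← hf, ← hJ]
    exact ⟨h.card_edges_lower_bound hI, fun h3 => h.card_edges_ne hI h3⟩
  · left
    have hdeg : ∀ a, 7 ≤ (edgeGraph p).degree a := by
      intro a
      have h1 := hp.finrank_le_degree a
      rw [hd] at h1
      exact Nat.lt_of_le_of_ne h1 fun e => hsimple ⟨a, e.symm⟩
    have hsum := (edgeGraph p).sum_degrees_eq_twice_card_edges
    have hle := Finset.sum_le_sum fun a (_ : a ∈ Finset.univ) => hdeg a
    rw [hsum, Finset.sum_const, Finset.card_univ, hk, smul_eq_mul] at hle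
    rw [Set.ncard_eq_toFinset_card']
    change _ ≤ 2 * (edgeGraph p).edgeFinset.card
    omega

end SimpleVertex

theorem card_edges_of_mem_fPairs {k e : ℕ} (h : (7 + k, e) ∈ fPairs 6) :
    7 * (7 + k) ≤ 2 * e ∨ 42 + 11 * k ≤ 2 * e + k ^ 2 ∧ (k = 3 → e ≠ 34) := by
  obtain ⟨n, P, hP, h0, h1⟩ := h
  obtain ⟨p, hp, hf, hd⟩ := hP.exists_family
  rw [← show f₁ P = e from h1, hf]
  exact hp.card_edges_of_finrank_eq_six hd (by rw [Fintype.card_fin]; exact h0)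

/-- Seven exceptional pairs are not in `E^6`, and `(f0+1, ⌊(7/2)·f0 + 1⌋) ∉ E^6`
for `f0 = 7, 8, 9`. -/
theorem stmt2 :
    ((8, 24) ∉ fPairs 6 ∧ (9, 27) ∉ fPairs 6 ∧ (9, 29) ∉ fPairs 6 ∧
      (10, 30) ∉ fPairs 6 ∧ (10, 32) ∉ fPairs 6 ∧ (10, 34) ∉ fPairs 6 ∧
      (11, 33) ∉ fPairs 6) ∧
    ∀ f0 : ℕ, f0 = 7 ∨ f0 = 8 ∨ f0 = 9 → (f0 + 1, 7 * f0 / 2 + 1) ∉ fPairs 6 := by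
  refine ⟨⟨?_, ?_, ?_, ?_, ?_, ?_, ?_⟩, ?_⟩
  · exact fun h => absurd (card_edges_of_mem_fPairs (k := 1) h) (by norm_num)
  · exact fun h => absurd (card_edges_of_mem_fPairs (k := 2) h) (by norm_num)
  · exact fun h => absurd (card_edges_of_mem_fPairs (k := 2) h) (by norm_num)
  · exact fun h => absurd (card_edges_of_mem_fPairs (k := 3) h) (by norm_num)
  · exact fun h => absurd (card_edges_of_mem_fPairs (k := 3) h) (by norm_num)
  · exact fun h => absurd (card_edges_of_mem_fPairs (k := 3) h) (by norm_num)
  · exact fun h => absurd (card_edges_of_mem_fPairs (k := 4) h) (by norm_num)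
  · rintro f0 (rfl | rfl | rfl) h
    · exact absurd (card_edges_of_mem_fPairs (k := 1) h) (by norm_num)
    · exact absurd (card_edges_of_mem_fPairs (k := 2) h) (by norm_num)
    · exact absurd (card_edges_of_mem_fPairs (k := 3) h) (by norm_num)
end
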